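/- Let Ω be a uniform domain with admissible Whitney covering W, 0 < s < 1, 1 ≤ q ≤ p < ∞, and f ∈ L¹_loc(Ω). Then ( Σ_{Q∈W} ∫_Q ( ∫_{5Q} |f(x)−f(y)|^q / |x−y|^{sq+d} dy )^{p/q} dx )^{1/p} ≈ ( ∫_Ω ( ∫_Ω |f(x)−f(y)|^q / |x−y|^{sq+d} dy )^{p/q} dx )^{1/p}, with comparability constants depending only on d, s, p, q and the uniformity constants of Ω. -/

import Mathlib

open MeasureTheory ENNReal

/-- An axis-parallel cube in `ℝ^d`, identified with the closed ball of radius `side/2`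
around its center in the sup metric on `Fin d → ℝ`. -/
structure Cube (d : ℕ) where
  center : Fin d → ℝ
  side : ℝ
  side_pos : 0 < side

/-- The set of points of a cube. -/
def Cube.toSet {d : ℕ} (Q : Cube d) : Set (Fin d → ℝ) :=
  Metric.closedBall Q.center (Q.side / 2)

/-- Distance between two sets. -/
noncomputable def setDist {d : ℕ} (A B : Set (Fin d → ℝ)) : ℝ :=
  sInf (Set.image2 dist A B)

/-- The long distance `D(Q,S) = ℓ(Q) + ℓ(S) + dist(Q,S)` between two cubes. -/
noncomputable def longDist {d : ℕ} (Q S : Cube d) : ℝ :=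
  Q.side + S.side + setDist Q.toSet S.toSet

/-- A Whitney covering of `Ω`: a family of essentially disjoint (dyadic-type) cubes whose
union is `Ω`, with side-lengths comparable to the distance to `∂Ω`, and finite
superposition of the dilated cubes `50Q`. -/
structure WhitneyCovering (d : ℕ) (Ω : Set (Fin d → ℝ)) where
  cubes : Set (Cube d)
  covers : (⋃ Q ∈ cubes, Q.toSet) = Ω
  essDisjoint : ∀ Q ∈ cubes, ∀ S ∈ cubes, Q ≠ S →
    interior Q.toSet ∩ interior S.toSet = ∅
  CW : ℝ
  one_le_CW : 1 ≤ CW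
  dist_lb : ∀ Q ∈ cubes, CW * Q.side ≤ setDist Q.toSet (frontier Ω)
  dist_ub : ∀ Q ∈ cubes, setDist Q.toSet (frontier Ω) ≤ 4 * CW * Q.side
  finiteOverlap : ∃ N : ℕ, ∀ x : Fin d → ℝ,
    {Q ∈ cubes | x ∈ Metric.closedBall Q.center (25 * Q.side)}.Finite ∧
    {Q ∈ cubes | x ∈ Metric.closedBall Q.center (25 * Q.side)}.ncard ≤ N

/-- `S ∈ SH_ρ(P)` : the cube `S` of the covering lies in the `ρ`-shadow of `P`, i.e.
`S ⊆ B(x_P, ρ ℓ(P))`. -/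
def memShadow {d : ℕ} {Ω : Set (Fin d → ℝ)} (W : WhitneyCovering d Ω) (ρ : ℝ)
    (S P : Cube d) : Prop :=
  S ∈ W.cubes ∧ P ∈ W.cubes ∧ S.toSet ⊆ Metric.closedBall P.center (ρ * P.side)

/-- An `ε`-admissible chain of Whitney cubes joining `Q` to `S`. -/
structure AdmissibleChain {d : ℕ} {Ω : Set (Fin d → ℝ)} (W : WhitneyCovering d Ω)
    (ε : ℝ) (Q S : Cube d) where
  M : ℕ
  M_pos : 0 < M
  c : Fin M → Cube d
  mem : ∀ j, c j ∈ W.cubes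
  first : c ⟨0, M_pos⟩ = Q
  last : c ⟨M - 1, Nat.sub_lt M_pos Nat.one_pos⟩ = S
  neighbors : ∀ (j : ℕ) (h : j + 1 < M),
    ((c ⟨j, Nat.lt_of_succ_lt h⟩).toSet ∩ (c ⟨j + 1, h⟩).toSet).Nonempty
  length_le : ∑ j, (c j).side ≤ ε⁻¹ * longDist Q S
  j₀ : Fin M
  growth₁ : ∀ j : Fin M, j ≤ j₀ → ε * longDist Q (c j) ≤ (c j).side
  growth₂ : ∀ j : Fin M, j₀ ≤ j → ε * longDist (c j) S ≤ (c j).side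

/-- `Ω` (with Whitney covering `W`) is an `ε`-uniform domain: any two Whitney cubes are
joined by an `ε`-admissible chain. -/
def IsUniformDomain {d : ℕ} {Ω : Set (Fin d → ℝ)} (W : WhitneyCovering d Ω) (ε : ℝ) : Prop :=
  ∀ Q ∈ W.cubes, ∀ S ∈ W.cubes, Nonempty (AdmissibleChain W ε Q S)

/-- The non-centered Hardy–Littlewood maximal function, taken over cubes
(closed balls in the sup metric on `Fin d → ℝ`) containing `x`. -/
noncomputable def maximal (d : ℕ) (g : (Fin d → ℝ) → ℝ≥0∞) (x : Fin d → ℝ) : ℝ≥0∞ :=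
  ⨆ (c : Fin d → ℝ) (r : ℝ) (_ : 0 < r) (_ : x ∈ Metric.closedBall c r),
    (∫⁻ y in Metric.closedBall c r, g y) / volume (Metric.closedBall c r)

namespace Cube

variable {d : ℕ}

/-- A long distance between cubes measured through their centers. -/
noncomputable def centerDist (Q S : Cube d) : ℝ :=
  Q.side + S.side + dist Q.center S.center

lemma centerDist_comm (Q S : Cube d) : Q.centerDist S = S.centerDist Q := by
  simp only [centerDist, dist_comm Q.center S.center]; ring

lemma centerDist_triangle (Q R S : Cube d) :
    Q.centerDist S ≤ Q.centerDist R + R.centerDist S := by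
  have := dist_triangle Q.center R.center S.center
  have := R.side_pos
  simp only [centerDist]; linarith

lemma side_le_centerDist_left (Q S : Cube d) : Q.side ≤ Q.centerDist S := by
  have := S.side_pos
  have := dist_nonneg (x := Q.center) (y := S.center)
  simp only [centerDist]; linarith

lemma side_le_centerDist_right (Q S : Cube d) : S.side ≤ Q.centerDist S :=
  centerDist_comm S Q ▸ side_le_centerDist_left S Q

lemma centerDist_pos (Q S : Cube d) : 0 < Q.centerDist S :=
  Q.side_pos.trans_le (side_le_centerDist_left Q S)

lemma center_mem_toSet (Q : Cube d) : Q.center ∈ Q.toSet :=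
  Metric.mem_closedBall_self (by have := Q.side_pos; positivity)

lemma dist_center_le {Q : Cube d} {x : Fin d → ℝ} (hx : x ∈ Q.toSet) :
    dist x Q.center ≤ Q.side / 2 := hx

lemma bddBelow_image2_dist (A B : Set (Fin d → ℝ)) : BddBelow (Set.image2 dist A B) :=
  ⟨0, by rintro _ ⟨x, _, y, _, rfl⟩; exact dist_nonneg⟩

lemma setDist_le {A B : Set (Fin d → ℝ)} {x y : Fin d → ℝ} (hx : x ∈ A) (hy : y ∈ B) :
    setDist A B ≤ dist x y :=
  csInf_le (bddBelow_image2_dist A B) ⟨x, hx, y, hy, rfl⟩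

lemma longDist_le_centerDist (Q S : Cube d) : longDist Q S ≤ Q.centerDist S := by
  have := setDist_le Q.center_mem_toSet S.center_mem_toSet
  simp only [longDist, centerDist]; linarith

lemma centerDist_le_dist {Q S : Cube d} {x y : Fin d → ℝ} (hx : x ∈ Q.toSet) (hy : y ∈ S.toSet) :
    dist Q.center S.center ≤ Q.side / 2 + S.side / 2 + dist x y := by
  have h1 := dist_center_le hx
  have h2 := dist_center_le hy
  have := dist_triangle4 Q.center x y S.center
  rw [dist_comm Q.center x] at this
  linarith

lemma centerDist_le_two_mul_longDist (Q S : Cube d) : Q.centerDist S ≤ 2 * longDist Q S := by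
  have h : dist Q.center S.center - (Q.side / 2 + S.side / 2) ≤ setDist Q.toSet S.toSet := by
    refine le_csInf ⟨_, Q.center, Q.center_mem_toSet, S.center, S.center_mem_toSet, rfl⟩ ?_
    rintro _ ⟨x, hx, y, hy, rfl⟩
    have := centerDist_le_dist hx hy
    linarith
  have h0 : 0 ≤ setDist Q.toSet S.toSet :=
    Real.sInf_nonneg (by rintro _ ⟨x, _, y, _, rfl⟩; exact dist_nonneg)
  have := Q.side_pos
  have := S.side_pos
  simp only [longDist, centerDist]; linarith

lemma measurableSet_toSet (Q : Cube d) : MeasurableSet Q.toSet :=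
  Metric.isClosed_closedBall.measurableSet

lemma volume_toSet (Q : Cube d) : volume Q.toSet = ENNReal.ofReal (Q.side ^ (d : ℝ)) := by
  rw [toSet, Real.volume_pi_closedBall _ (by have := Q.side_pos; positivity),
    mul_div_cancel₀ _ two_ne_zero, Fintype.card_fin, Real.rpow_natCast]

lemma volume_toSet_ne_zero (Q : Cube d) : volume Q.toSet ≠ 0 := by
  rw [volume_toSet]
  have := Real.rpow_pos_of_pos Q.side_pos d
  simpa using this

lemma volume_toSet_ne_top (Q : Cube d) : volume Q.toSet ≠ ⊤ := by
  rw [volume_toSet]; exact ENNReal.ofReal_ne_top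

end Cube

namespace WhitneyCovering

variable {d : ℕ} {Ω : Set (Fin d → ℝ)} (W : WhitneyCovering d Ω)

/-- The cubes of the covering as a type. -/
abbrev Index : Type := {Q : Cube d // Q ∈ W.cubes}

lemma interior_toSet (Q : Cube d) : interior Q.toSet = Metric.ball Q.center (Q.side / 2) :=
  interior_closedBall _ (by have := Q.side_pos; positivity)

lemma aedisjoint_toSet :
    Pairwise (fun Q S : W.Index ↦ AEDisjoint volume Q.1.toSet S.1.toSet) := by
  intro Q S hQS
  have h := W.essDisjoint Q.1 Q.2 S.1 S.2 (fun h ↦ hQS (Subtype.ext h))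
  have hf : ∀ R : Cube d, volume (frontier R.toSet) = 0 := fun R ↦
    (convex_closedBall R.center (R.side / 2)).addHaar_frontier volume
  refine measure_mono_null (t := frontier Q.1.toSet ∪ frontier S.1.toSet) ?_
    (measure_union_null (hf _) (hf _))
  rintro x ⟨hx, hy⟩
  by_contra hn
  simp only [Set.mem_union, not_or, frontier, Set.mem_sdiff, not_and, not_not] at hn
  have : x ∈ interior Q.1.toSet ∩ interior S.1.toSet :=
    ⟨hn.1 (subset_closure hx), hn.2 (subset_closure hy)⟩
  simp [h] at this

lemma countable_cubes : W.cubes.Countable := by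
  refine Set.PairwiseDisjoint.countable_of_isOpen (s := fun Q ↦ interior Q.toSet) ?_
    (fun _ _ ↦ isOpen_interior) ?_
  · intro Q hQ S hS h
    exact Set.disjoint_iff_inter_eq_empty.2 (W.essDisjoint Q hQ S hS h)
  · intro Q _
    rw [interior_toSet]
    exact ⟨Q.center, Metric.mem_ball_self (by have := Q.side_pos; positivity)⟩

instance : Countable W.Index := W.countable_cubes.to_subtype

lemma iUnion_toSet : (⋃ Q : W.Index, Q.1.toSet) = Ω :=
  (Set.biUnion_eq_iUnion _ _).symm.trans W.covers

lemma toSet_subset {Q : Cube d} (hQ : Q ∈ W.cubes) : Q.toSet ⊆ Ω := by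
  rw [← W.covers]
  exact Set.subset_biUnion_of_mem hQ

lemma tsum_setLIntegral (g : (Fin d → ℝ) → ℝ≥0∞) :
    ∑' Q : W.Index, ∫⁻ x in Q.1.toSet, g x = ∫⁻ x in Ω, g x := by
  rw [← lintegral_iUnion₀ (fun Q : W.Index ↦ Q.1.measurableSet_toSet.nullMeasurableSet)
    W.aedisjoint_toSet, W.iUnion_toSet]

lemma side_le {Q S : Cube d} (hQ : Q ∈ W.cubes) (hS : S ∈ W.cubes) {x y : Fin d → ℝ}
    (hx : x ∈ Q.toSet) (hy : y ∈ S.toSet) : S.side ≤ 5 * Q.side + dist x y := by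
  have hW := W.one_le_CW
  have hQs := Q.side_pos
  have hSs := S.side_pos
  have hne : (Set.image2 dist Q.toSet (frontier Ω)).Nonempty := by
    by_contra h
    have h1 := W.dist_lb Q hQ
    rw [setDist, Set.not_nonempty_iff_eq_empty.1 h, Real.sInf_empty] at h1
    nlinarith
  have key : W.CW * S.side ≤ dist x y + (4 * W.CW + 1) * Q.side := by
    refine le_of_forall_pos_le_add fun δ hδ ↦ ?_
    have hlt : sInf (Set.image2 dist Q.toSet (frontier Ω)) < 4 * W.CW * Q.side + δ :=
      lt_of_le_of_lt (W.dist_ub Q hQ) (by linarith)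
    obtain ⟨_, ⟨x', hx', z, hz, rfl⟩, hlt⟩ := exists_lt_of_csInf_lt hne hlt
    have h1 := (W.dist_lb S hS).trans (Cube.setDist_le hy hz)
    have h2 := dist_triangle4 y x x' z
    have h3 := dist_triangle_right x x' Q.center
    have h4 := Cube.dist_center_le hx
    have h5 := Cube.dist_center_le hx'
    rw [dist_comm y x] at h2
    nlinarith
  have hd := dist_nonneg (x := x) (y := y)
  by_contra! hlt
  have : W.CW * (5 * Q.side + dist x y) < W.CW * S.side := by gcongr
  nlinarith

lemma side_le_of_touch {Q S : Cube d} (hQ : Q ∈ W.cubes) (hS : S ∈ W.cubes)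
    (h : (Q.toSet ∩ S.toSet).Nonempty) : S.side ≤ 5 * Q.side := by
  obtain ⟨x, hx, hy⟩ := h
  simpa using W.side_le hQ hS hx hy

lemma centerDist_le_of_far {Q S : Cube d} (hQ : Q ∈ W.cubes) (hS : S ∈ W.cubes)
    {x y : Fin d → ℝ} (hx : x ∈ Q.toSet) (hy : y ∈ S.toSet)
    (hfar : y ∉ Metric.closedBall Q.center (5 * Q.side / 2)) :
    Q.centerDist S ≤ 7 * dist x y := by
  have h1 := W.side_le hQ hS hx hy
  have h2 := Cube.centerDist_le_dist hx hy
  have h3 := Cube.dist_center_le hx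
  rw [Metric.mem_closedBall, not_le] at hfar
  have h4 := dist_triangle y x Q.center
  rw [dist_comm y x] at h4
  simp only [Cube.centerDist]
  linarith

end WhitneyCovering

lemma lintegral_one_add_norm_inv_smul {d : ℕ} (r : ℝ) (c : Fin d → ℝ) {t : ℝ} (ht : 0 < t) :
    ∫⁻ y : Fin d → ℝ, ENNReal.ofReal ((1 + ‖t⁻¹ • (y - c)‖) ^ (-r)) =
      ENNReal.ofReal (t ^ (d : ℝ)) *
        ∫⁻ y : Fin d → ℝ, ENNReal.ofReal ((1 + ‖y‖) ^ (-r)) := by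
  rw [lintegral_sub_right_eq_self
    (fun y : Fin d → ℝ ↦ ENNReal.ofReal ((1 + ‖t⁻¹ • y‖) ^ (-r))) c]
  have hm : Measurable fun y : Fin d → ℝ ↦ ENNReal.ofReal ((1 + ‖y‖) ^ (-r)) := by fun_prop
  have h := lintegral_map (μ := volume) hm (measurable_const_smul (t⁻¹ : ℝ))
  rw [Measure.map_addHaar_smul _ (inv_ne_zero ht.ne'), lintegral_smul_measure] at h
  rw [← h, Module.finrank_fin_fun, inv_pow, inv_inv, abs_of_pos (pow_pos ht d),
    Real.rpow_natCast, smul_eq_mul]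

namespace WhitneyCovering

lemma exists_tsum_kernel_le (d : ℕ) {a : ℝ} (ha : 0 < a) : ∃ C : ℝ, 0 < C ∧
    ∀ (Ω : Set (Fin d → ℝ)) (W : WhitneyCovering d Ω) (c : Fin d → ℝ) (t : ℝ), 0 < t →
      ∑' R : W.Index, ENNReal.ofReal
        (R.1.side ^ (d : ℝ) * (R.1.side + dist R.1.center c + t) ^ (-(a + d))) ≤
      ENNReal.ofReal (C * t ^ (-a)) := by
  have hfin : ∫⁻ y : Fin d → ℝ, ENNReal.ofReal ((1 + ‖y‖) ^ (-(a + d))) < ⊤ :=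
    finite_integral_one_add_norm (by simpa using ha)
  set I := ∫⁻ y : Fin d → ℝ, ENNReal.ofReal ((1 + ‖y‖) ^ (-(a + d)))
  refine ⟨I.toReal + 1, by positivity, fun Ω W c t ht ↦ ?_⟩
  have hda : 0 ≤ a + d := by positivity
  calc _ ≤ ∑' R : W.Index, ∫⁻ y in R.1.toSet, ENNReal.ofReal ((t + dist y c) ^ (-(a + d))) := by
        refine ENNReal.tsum_le_tsum fun R ↦ ?_
        have hs := R.1.side_pos
        rw [ENNReal.ofReal_mul (by positivity), ← R.1.volume_toSet, mul_comm]
        rw [← setLIntegral_const]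
        refine setLIntegral_mono' R.1.measurableSet_toSet fun y hy ↦ ?_
        refine ENNReal.ofReal_le_ofReal (Real.rpow_le_rpow_of_nonpos (by positivity) ?_ (by linarith))
        have h1 := Cube.dist_center_le hy
        have h2 := dist_triangle y R.1.center c
        linarith
    _ = ∫⁻ y in Ω, ENNReal.ofReal ((t + dist y c) ^ (-(a + d))) := W.tsum_setLIntegral _
    _ ≤ ∫⁻ y, ENNReal.ofReal ((t + dist y c) ^ (-(a + d))) := setLIntegral_le_lintegral _ _
    _ = ∫⁻ y, ENNReal.ofReal (t ^ (-(a + d))) *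
          ENNReal.ofReal ((1 + ‖t⁻¹ • (y - c)‖) ^ (-(a + d))) := by
        refine lintegral_congr fun y ↦ ?_
        rw [← ENNReal.ofReal_mul (by positivity), ← Real.mul_rpow ht.le (by positivity),
          norm_smul, norm_inv, Real.norm_of_nonneg ht.le, dist_eq_norm]
        congr 2
        field_simp
    _ = ENNReal.ofReal (t ^ (-(a + d))) * (ENNReal.ofReal (t ^ (d : ℝ)) * I) := by
        rw [lintegral_const_mul' _ _ ENNReal.ofReal_ne_top, lintegral_one_add_norm_inv_smul _ c ht]
    _ ≤ ENNReal.ofReal (t ^ (-(a + d))) *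
          (ENNReal.ofReal (t ^ (d : ℝ)) * ENNReal.ofReal (I.toReal + 1)) := by
        gcongr
        rw [← ENNReal.ofReal_toReal hfin.ne]
        exact ENNReal.ofReal_le_ofReal (by simp)
    _ = _ := by
        rw [← ENNReal.ofReal_mul (by positivity), ← ENNReal.ofReal_mul (by positivity)]
        rw [← mul_assoc, ← Real.rpow_add ht, mul_comm]
        congr 3
        ring

lemma exists_tsum_centerDist_le (d : ℕ) {a : ℝ} (ha : 0 < a) : ∃ C : ℝ, 0 < C ∧
    ∀ (Ω : Set (Fin d → ℝ)) (W : WhitneyCovering d Ω) (P : Cube d),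
      ∑' R : W.Index, ENNReal.ofReal (R.1.side ^ (d : ℝ) * R.1.centerDist P ^ (-(a + d))) ≤
      ENNReal.ofReal (C * P.side ^ (-a)) := by
  obtain ⟨C, hC, h⟩ := exists_tsum_kernel_le d ha
  refine ⟨C, hC, fun Ω W P ↦ ?_⟩
  convert h Ω W P.center P.side P.side_pos using 5
  rw [Cube.centerDist, add_right_comm]

/-- Cubes of side at most `Λ` whose shadow contains a fixed point have geometrically
summable side-lengths. -/
lemma exists_tsum_shadow_le (d : ℕ) {a : ℝ} (ha : 0 < a) (B : ℝ) : ∃ C : ℝ, 0 < C ∧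
    ∀ (Ω : Set (Fin d → ℝ)) (W : WhitneyCovering d Ω) (c : Fin d → ℝ) (Λ : ℝ), 0 < Λ →
      ∑' R : W.Index, (if dist R.1.center c ≤ B * R.1.side ∧ R.1.side ≤ Λ then
        ENNReal.ofReal (R.1.side ^ a) else 0) ≤ ENNReal.ofReal (C * Λ ^ a) := by
  obtain ⟨C, hC, h⟩ := exists_tsum_kernel_le d ha
  set B' := |B| + 3 with hB'
  have hB'pos : 0 < B' := by positivity
  set θ : ℝ := (1 / 2) ^ a with hθ
  have hθ0 : 0 < θ := by positivity
  have hθ1 : θ < 1 := Real.rpow_lt_one (by norm_num) (by norm_num) ha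
  have hs : Summable fun k : ℕ ↦ θ ^ k := summable_geometric_of_lt_one hθ0.le hθ1
  refine ⟨B' ^ (a + d) * C * (1 - θ)⁻¹, by have := sub_pos.2 hθ1; positivity,
    fun Ω W c Λ hΛ ↦ ?_⟩
  have hpow : ∀ k : ℕ, (Λ * (1 / 2) ^ k) ^ a = Λ ^ a * θ ^ k := fun k ↦ by
    rw [Real.mul_rpow hΛ.le (by positivity), ← Real.rpow_natCast, ← Real.rpow_natCast,
      ← Real.rpow_mul (by norm_num), ← Real.rpow_mul (by norm_num), mul_comm (k : ℝ)]
  calc _ ≤ ∑' R : W.Index, ∑' k : ℕ, ENNReal.ofReal (B' ^ (a + d) * (Λ * (1 / 2) ^ k) ^ (2 * a)) *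
          ENNReal.ofReal (R.1.side ^ (d : ℝ) *
            (R.1.side + dist R.1.center c + Λ * (1 / 2) ^ k) ^ (-(a + d))) := by
        refine ENNReal.tsum_le_tsum fun R ↦ ?_
        split_ifs with hR
        swap
        · exact zero_le
        obtain ⟨h1, h2⟩ := hR
        have hsR := R.1.side_pos
        obtain ⟨k, hk1, hk2⟩ := exists_nat_pow_near_of_lt_one (x := R.1.side / Λ) (y := (1 / 2 : ℝ))
          (by positivity) (by rw [div_le_one hΛ]; exact h2) (by norm_num) (by norm_num)
        rw [div_le_iff₀ hΛ] at hk2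
        rw [lt_div_iff₀ hΛ, pow_succ] at hk1
        refine le_trans ?_ (ENNReal.le_tsum k)
        set τ := Λ * (1 / 2) ^ k with hτ
        have hτ0 : 0 < τ := by positivity
        have hτ1 : R.1.side ≤ τ := by rw [hτ]; linarith
        have hτ2 : τ ≤ 2 * R.1.side := by rw [hτ]; linarith
        rw [← ENNReal.ofReal_mul (by positivity)]
        refine ENNReal.ofReal_le_ofReal ?_
        have hX : R.1.side + dist R.1.center c + τ ≤ B' * R.1.side := by
          have : B * R.1.side ≤ |B| * R.1.side := by gcongr; exact le_abs_self B
          rw [hB']; linarith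
        calc R.1.side ^ a = B' ^ (a + d) * R.1.side ^ (2 * a) *
              (R.1.side ^ (d : ℝ) * (B' * R.1.side) ^ (-(a + d))) := by
              rw [Real.mul_rpow hB'pos.le hsR.le, Real.rpow_neg hB'pos.le]
              have e : R.1.side ^ (2 * a) * (R.1.side ^ (d : ℝ) * R.1.side ^ (-(a + d))) =
                  R.1.side ^ a := by
                rw [← Real.rpow_add hsR, ← Real.rpow_add hsR]; congr 1; ring
              rw [← e]
              field_simp
          _ ≤ _ := by
              have hda : 0 ≤ a + d := by positivity
              have := Real.rpow_le_rpow_of_nonpos (z := -(a + d)) (by positivity) hX (by linarith)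
              gcongr
    _ = ∑' k : ℕ, ENNReal.ofReal (B' ^ (a + d) * (Λ * (1 / 2) ^ k) ^ (2 * a)) *
          ∑' R : W.Index, ENNReal.ofReal (R.1.side ^ (d : ℝ) *
            (R.1.side + dist R.1.center c + Λ * (1 / 2) ^ k) ^ (-(a + d))) := by
        rw [ENNReal.tsum_comm]
        simp_rw [ENNReal.tsum_mul_left]
    _ ≤ ∑' k : ℕ, ENNReal.ofReal (B' ^ (a + d) * (Λ * (1 / 2) ^ k) ^ (2 * a)) *
          ENNReal.ofReal (C * (Λ * (1 / 2) ^ k) ^ (-a)) := by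
        gcongr with k
        exact h Ω W c _ (by positivity)
    _ = ∑' k : ℕ, ENNReal.ofReal (B' ^ (a + d) * C * Λ ^ a * θ ^ k) := by
        refine tsum_congr fun k ↦ ?_
        rw [← ENNReal.ofReal_mul (by positivity), mul_assoc _ _ (θ ^ k), ← hpow k]
        have hτ0 : 0 < Λ * (1 / 2) ^ k := by positivity
        have e : (Λ * (1 / 2) ^ k) ^ a =
            (Λ * (1 / 2) ^ k) ^ (2 * a) * (Λ * (1 / 2) ^ k) ^ (-a) := by
          rw [← Real.rpow_add hτ0]; congr 1; ring
        rw [e]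
        ring_nf
    _ = _ := by
        rw [← ENNReal.ofReal_tsum_of_nonneg (fun k ↦ by positivity) (hs.mul_left _), tsum_mul_left,
          tsum_geometric_of_lt_one hθ0.le hθ1]
        ring_nf

end WhitneyCovering

lemma edist_add_le_two_mul_sum_support {α : Type*} {G : SimpleGraph α} {A : α → ℝ}
    {w : α → ℝ≥0∞} (h : ∀ a b, G.Adj a b → edist (A a) (A b) ≤ w a + w b) {u v : α}
    (p : G.Walk u v) : edist (A u) (A v) + w u ≤ 2 * (p.support.map w).sum := by
  induction p with
  | nil => simpa using le_mul_of_one_le_left zero_le one_le_two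
  | @cons u m v hadj p ih =>
    calc edist (A u) (A v) + w u ≤ (edist (A u) (A m) + edist (A m) (A v)) + w u := by
          gcongr; exact edist_triangle _ _ _
      _ ≤ ((w u + w m) + edist (A m) (A v)) + w u := by gcongr; exact h _ _ hadj
      _ = 2 * w u + (edist (A m) (A v) + w m) := by ring
      _ ≤ 2 * w u + 2 * (p.support.map w).sum := by gcongr
      _ = _ := by simp [mul_add]

/-- `R` lies between `Q` and `P` when it is large enough to sit on a chain joining them. -/
def Cube.Between {d : ℕ} (B : ℝ) (Q R P : Cube d) : Prop :=
  Q.centerDist R * R.centerDist P ≤ B * R.side * Q.centerDist P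

/-- The constant for which cubes in `ε`-admissible chains lie between the endpoints. -/
noncomputable def chainConst (ε : ℝ) : ℝ := 2 / ε * (2 / ε * ε⁻¹ + 1)

lemma chainConst_pos {ε : ℝ} (hε : 0 < ε) : 0 < chainConst ε := by
  unfold chainConst; positivity

lemma AdmissibleChain.between {d : ℕ} {Ω : Set (Fin d → ℝ)} {W : WhitneyCovering d Ω} {ε : ℝ}
    (hε : 0 < ε) {Q P : Cube d} (c : AdmissibleChain W ε Q P) (j : Fin c.M) :
    Cube.Between (chainConst ε) Q (c.c j) P := by
  set R := c.c j
  have hRs : R.side ≤ ε⁻¹ * Q.centerDist P := by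
    refine le_trans ?_ (c.length_le.trans (by gcongr; exact Q.longDist_le_centerDist P))
    exact Finset.single_le_sum (f := fun j ↦ (c.c j).side) (fun i _ ↦ (c.c i).side_pos.le)
      (Finset.mem_univ j)
  have hRp := R.side_pos
  have hQR := Q.centerDist_pos R
  have hRP := R.centerDist_pos P
  have hQP := Q.centerDist_pos P
  have main : ∀ {u v : ℝ}, 0 < v → u ≤ 2 * (ε⁻¹ * R.side) → v ≤ u + Q.centerDist P →
      u * v ≤ chainConst ε * R.side * Q.centerDist P := by
    intro u v hv hu hvu
    have h1 : v ≤ (2 / ε * ε⁻¹ + 1) * Q.centerDist P := by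
      calc v ≤ 2 * (ε⁻¹ * (ε⁻¹ * Q.centerDist P)) + Q.centerDist P := by
            refine hvu.trans ?_
            gcongr
            refine hu.trans ?_
            gcongr
        _ = _ := by ring
    calc u * v ≤ (2 * (ε⁻¹ * R.side)) * ((2 / ε * ε⁻¹ + 1) * Q.centerDist P) := by gcongr
      _ = _ := by unfold chainConst; ring
  rcases le_total j c.j₀ with hj | hj
  · refine main hRP ?_ ?_
    · refine (Q.centerDist_le_two_mul_longDist R).trans ?_
      gcongr
      rw [inv_mul_eq_div, le_div_iff₀ hε, mul_comm]
      exact c.growth₁ j hj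
    · rw [Q.centerDist_comm R]
      exact R.centerDist_triangle Q P
  · rw [Cube.Between, mul_comm]
    refine main hQR ?_ ?_
    · refine (R.centerDist_le_two_mul_longDist P).trans ?_
      gcongr
      rw [inv_mul_eq_div, le_div_iff₀ hε, mul_comm]
      exact c.growth₂ j hj
    · have := Q.centerDist_triangle P R
      rw [R.centerDist_comm P]
      linarith

open scoped Classical in
lemma IsUniformDomain.edist_le_tsum {d : ℕ} {Ω : Set (Fin d → ℝ)} {W : WhitneyCovering d Ω} {ε : ℝ}
    (hε : 0 < ε) (hW : IsUniformDomain W ε) {A : W.Index → ℝ} {w : W.Index → ℝ≥0∞}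
    (h : ∀ R S : W.Index, (R.1.toSet ∩ S.1.toSet).Nonempty → edist (A R) (A S) ≤ w R + w S)
    (Q P : W.Index) : edist (A Q) (A P) ≤
      2 * ∑' R : W.Index, if Cube.Between (chainConst ε) Q.1 R.1 P.1 then w R else 0 := by
  obtain ⟨c⟩ := hW Q.1 Q.2 P.1 P.2
  let B : W.Index → Prop := fun R ↦ Cube.Between (chainConst ε) Q.1 R.1 P.1
  let G : SimpleGraph W.Index :=
    { Adj := fun R S ↦ R ≠ S ∧ (R.1.toSet ∩ S.1.toSet).Nonempty ∧ B R ∧ B S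
      symm := ⟨fun R S h ↦ ⟨h.1.symm, by rw [Set.inter_comm]; exact h.2.1, h.2.2.2, h.2.2.1⟩⟩
      loopless := ⟨fun R h ↦ h.1 rfl⟩ }
  have hreach : ∀ (j : ℕ) (hj : j < c.M), G.Reachable Q ⟨c.c ⟨j, hj⟩, c.mem _⟩ := by
    intro j
    induction j with
    | zero =>
      intro hj
      have : Q = ⟨c.c ⟨0, hj⟩, c.mem _⟩ := Subtype.ext c.first.symm
      exact this ▸ SimpleGraph.Reachable.refl _
    | succ j ih =>
      intro hj
      refine (ih (Nat.lt_of_succ_lt hj)).trans ?_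
      by_cases heq : (⟨c.c ⟨j, Nat.lt_of_succ_lt hj⟩, c.mem _⟩ : W.Index) =
          ⟨c.c ⟨j + 1, hj⟩, c.mem _⟩
      · rw [heq]
      · exact SimpleGraph.Adj.reachable
          ⟨heq, c.neighbors j hj, c.between hε _, c.between hε _⟩
  have hQP : G.Reachable Q P := by
    have := hreach (c.M - 1) (Nat.sub_lt c.M_pos Nat.one_pos)
    have e : (⟨c.c ⟨c.M - 1, Nat.sub_lt c.M_pos Nat.one_pos⟩, c.mem _⟩ : W.Index) = P :=
      Subtype.ext c.last
    rwa [e] at this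
  obtain ⟨p, hp⟩ := hQP.exists_isPath
  have hsum := edist_add_le_two_mul_sum_support (A := A) (w := fun R ↦ if B R then w R else 0)
    (fun R S hRS ↦ by
      simp only [hRS.2.2.1, hRS.2.2.2, if_true]
      exact h R S hRS.2.1) p
  refine le_trans le_self_add (hsum.trans ?_)
  gcongr
  rw [← List.sum_toFinset _ hp.support_nodup]
  exact ENNReal.sum_le_tsum _

/-- Cubes between `Q` and `P` have summable powers of side-lengths. -/
lemma exists_tsum_between_le (d : ℕ) {a : ℝ} (ha : 0 < a) {B : ℝ} (hB : 0 < B) :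
    ∃ C : ℝ, 0 < C ∧ ∀ (Ω : Set (Fin d → ℝ)) (W : WhitneyCovering d Ω) (Q P : Cube d),
      (open scoped Classical in ∑' R : W.Index, if Cube.Between B Q R P then
        ENNReal.ofReal (R.1.side ^ a) else 0) ≤ ENNReal.ofReal (C * Q.centerDist P ^ a) := by
  classical
  obtain ⟨C, hC, h⟩ := WhitneyCovering.exists_tsum_shadow_le d ha (2 * B)
  refine ⟨2 * (C * B ^ a), by positivity, fun Ω W Q P ↦ ?_⟩
  have hQP := Q.centerDist_pos P
  set Λ := B * Q.centerDist P with hΛ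
  have hΛ0 : 0 < Λ := by positivity
  calc _ ≤ ∑' R : W.Index, ((if dist R.1.center Q.center ≤ 2 * B * R.1.side ∧ R.1.side ≤ Λ then
        ENNReal.ofReal (R.1.side ^ a) else 0) +
        (if dist R.1.center P.center ≤ 2 * B * R.1.side ∧ R.1.side ≤ Λ then
        ENNReal.ofReal (R.1.side ^ a) else 0)) := by
        refine ENNReal.tsum_le_tsum fun R ↦ ?_
        split_ifs with h1 h2 h3 h3 h2 h3 h3 <;> try simp
        have hs := R.1.side_pos
        have h4 := Q.side_le_centerDist_right R.1
        have h5 := R.1.side_le_centerDist_left P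
        have h6 := Q.centerDist_pos R.1
        have h7 := R.1.centerDist_pos P
        unfold Cube.Between at h1
        have hRΛ : R.1.side ≤ Λ := by
          have : R.1.side * R.1.side ≤ Λ * R.1.side := by
            calc R.1.side * R.1.side ≤ Q.centerDist R.1 * R.1.centerDist P := by gcongr
              _ ≤ _ := h1
              _ = _ := by rw [hΛ]; ring
          exact le_of_mul_le_mul_right this hs
        have h8 : 2 * B * R.1.side < Q.centerDist R.1 := by
          by_contra! hcon
          refine h2 ⟨?_, hRΛ⟩
          refine le_trans ?_ hcon
          simp only [Cube.centerDist, dist_comm R.1.center]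
          linarith [Q.side_pos]
        have h9 : 2 * B * R.1.side < R.1.centerDist P := by
          by_contra! hcon
          refine h3 ⟨?_, hRΛ⟩
          refine le_trans ?_ hcon
          simp only [Cube.centerDist]
          linarith [P.side_pos]
        have h10 := Q.centerDist_triangle R.1 P
        have : B * R.1.side * Q.centerDist P ≤
          B * R.1.side * (Q.centerDist R.1 + R.1.centerDist P) := by gcongr
        nlinarith [mul_lt_mul_of_pos_right h8 h7, mul_lt_mul_of_pos_right h9 h6]
    _ ≤ ENNReal.ofReal (C * Λ ^ a) + ENNReal.ofReal (C * Λ ^ a) := by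
        rw [ENNReal.tsum_add]
        exact add_le_add (h Ω W _ Λ hΛ0) (h Ω W _ Λ hΛ0)
    _ = _ := by
        rw [← ENNReal.ofReal_add (by positivity) (by positivity), hΛ, Real.mul_rpow hB.le hQP.le]
        ring_nf

lemma lintegral_rpow_le_measure_univ_mul {α : Type*} [MeasurableSpace α] (μ : Measure α)
    (f : α → ℝ≥0∞) {r : ℝ} (hr : 1 ≤ r) :
    (∫⁻ x, f x ∂μ) ^ r ≤ μ Set.univ ^ (r - 1) * ∫⁻ x, f x ^ r ∂μ := by
  rcases hr.eq_or_lt with rfl | hr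
  · simp
  obtain ⟨g, hg, hgf, hfg⟩ := exists_measurable_le_lintegral_eq μ f
  have hr0 : 0 < r := by linarith
  have hc := Real.HolderConjugate.conjExponent hr
  have h := ENNReal.lintegral_mul_le_Lp_mul_Lq μ hc hg.aemeasurable
    (aemeasurable_const (b := (1 : ℝ≥0∞)))
  simp only [Pi.mul_apply, mul_one, ENNReal.one_rpow, lintegral_const, one_mul] at h
  rw [hfg]
  calc (∫⁻ x, g x ∂μ) ^ r ≤ ((∫⁻ x, g x ^ r ∂μ) ^ (1 / r) *
        μ Set.univ ^ (1 / r.conjExponent)) ^ r := by gcongr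
    _ = μ Set.univ ^ (r - 1) * ∫⁻ x, g x ^ r ∂μ := by
        rw [ENNReal.mul_rpow_of_nonneg _ _ hr0.le, ← ENNReal.rpow_mul, ← ENNReal.rpow_mul,
          one_div_mul_cancel hr0.ne', ENNReal.rpow_one, mul_comm]
        congr 2
        have := hc.one_sub_inv
        rw [one_div, ← this]
        field_simp
    _ ≤ _ := by
        gcongr with x
        exact hgf x

lemma ENNReal.tsum_mul_rpow_le {ι : Type*} (m g : ι → ℝ≥0∞) {r : ℝ} (hr : 1 ≤ r) :
    (∑' i, m i * g i) ^ r ≤ (∑' i, m i) ^ (r - 1) * ∑' i, m i * g i ^ r := by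
  let _ : MeasurableSpace ι := ⊤
  have h := lintegral_rpow_le_measure_univ_mul (Measure.sum fun i ↦ m i • Measure.dirac i) g hr
  simpa [lintegral_sum_measure, lintegral_smul_measure, Measure.sum_apply] using h

lemma abs_rpow_sub_rpow_le {a b η : ℝ} (ha : 0 < a) (hb : 0 < b) (hab : a ≤ 5 * b)
    (hba : b ≤ 5 * a) (h0 : 0 ≤ η) (h1 : η ≤ 1) :
    |a ^ η - b ^ η| ≤ 4 * η * a ^ η + 4 * η * b ^ η := by
  have h5 : (5 : ℝ) ^ η ≤ 1 + η * 4 := by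
    have := rpow_one_add_le_one_add_mul_self (s := 4) (by norm_num) h0 h1
    norm_num at this ⊢
    exact this
  have key : ∀ {x y : ℝ}, 0 < x → 0 < y → x ≤ 5 * y → x ^ η - y ^ η ≤ 4 * η * y ^ η := by
    intro x y hx hy hxy
    have : x ^ η ≤ (1 + η * 4) * y ^ η := by
      calc x ^ η ≤ (5 * y) ^ η := by gcongr
        _ = 5 ^ η * y ^ η := Real.mul_rpow (by norm_num) hy.le
        _ ≤ _ := by gcongr
    linarith
  have ha' : 0 ≤ 4 * η * a ^ η := by positivity
  have hb' : 0 ≤ 4 * η * b ^ η := by positivity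
  rw [abs_le]
  constructor
  · linarith [key hb ha hba]
  · linarith [key ha hb hab]

lemma Cube.Between.rpow_neg_le {d : ℕ} {B : ℝ} (hB : 0 < B) {Q R P : Cube d}
    (h : Cube.Between B Q R P) {t : ℝ} (ht : 0 ≤ t) :
    Q.centerDist P ^ (-t) ≤
      B ^ t * (R.side ^ t * Q.centerDist R ^ (-t) * R.centerDist P ^ (-t)) := by
  have hQR := Q.centerDist_pos R
  have hRP := R.centerDist_pos P
  have hQP := Q.centerDist_pos P
  have hR := R.side_pos
  have h1 := Real.rpow_le_rpow (by positivity) h ht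
  rw [Real.mul_rpow hQR.le hRP.le, Real.mul_rpow (by positivity) hQP.le,
    Real.mul_rpow hB.le hR.le] at h1
  rw [Real.rpow_neg hQR.le, Real.rpow_neg hRP.le, Real.rpow_neg hQP.le]
  have e : B ^ t * (R.side ^ t * (Q.centerDist R ^ t)⁻¹ * (R.centerDist P ^ t)⁻¹) =
      (B ^ t * R.side ^ t) / (Q.centerDist R ^ t * R.centerDist P ^ t) := by
    field_simp
  rw [e, le_div_iff₀ (by positivity), inv_mul_le_iff₀ (by positivity), mul_comm (Q.centerDist P ^ t)]
  exact h1

lemma ENNReal.le_two_mul_of_le_add_half {S c : ℝ≥0∞} (hS : S ≠ ⊤) (h : S ≤ c + 2⁻¹ * S) :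
    S ≤ 2 * c := by
  rcases eq_or_ne c ⊤ with rfl | hc
  · simp
  lift S to NNReal using hS
  lift c to NNReal using hc
  have h2 : ((2⁻¹ : NNReal) : ℝ≥0∞) = 2⁻¹ := by simp
  rw [← h2] at h
  have h' : S ≤ c + 2⁻¹ * S := by exact_mod_cast h
  have h'' : S ≤ 2 * c := by
    have h3 : (S : ℝ) ≤ c + 2⁻¹ * S := by exact_mod_cast h'
    have : (S : ℝ) ≤ 2 * c := by linarith
    exact_mod_cast this
  exact_mod_cast h''

/-- In a uniform domain the Whitney decomposition remains summable against slightly negative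
powers of the side-lengths. -/
lemma exists_tsum_negative_power_le (d : ℕ) (hd : 1 ≤ d) {ε : ℝ} (hε : 0 < ε) {a : ℝ}
    (ha : 0 < a) : ∃ η₀ : ℝ, 0 < η₀ ∧ ∃ C : ℝ, 0 < C ∧ ∀ η : ℝ, 0 ≤ η → η ≤ η₀ →
      ∀ (Ω : Set (Fin d → ℝ)) (W : WhitneyCovering d Ω), IsUniformDomain W ε → ∀ P : W.Index,
      ∑' Q : W.Index, ENNReal.ofReal
        (Q.1.side ^ (d - η) * Q.1.centerDist P.1 ^ (-(a + d))) ≤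
      ENNReal.ofReal (C * P.1.side ^ (-(a + η))) := by
  classical
  obtain ⟨C₁, hC₁, hE⟩ := WhitneyCovering.exists_tsum_centerDist_le d ha
  set B := chainConst ε with hBdef
  have hB : 0 < B := chainConst_pos hε
  set K := 8 * B ^ (a + d) * C₁ with hK
  have hKpos : 0 < K := by positivity
  refine ⟨min 1 (1 / (2 * K)), by positivity, 2 * C₁, by positivity,
    fun η hη0 hη Ω W hW P₀ ↦ ?_⟩
  have hη1 : η ≤ 1 := hη.trans (min_le_left _ _)
  have hηK : η * K ≤ 2⁻¹ := by
    have := hη.trans (min_le_right _ _)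
    rw [le_div_iff₀ (by positivity)] at this
    linarith
  have hd' : (1 : ℝ) ≤ d := by exact_mod_cast hd
  let X : Finset W.Index → W.Index → ℝ≥0∞ := fun F P ↦ ∑ Q ∈ F, ENNReal.ofReal
    (Q.1.side ^ (d - η) * Q.1.centerDist P.1 ^ (-(a + d)) * P.1.side ^ (a + η))
  have hXF : ∀ F P, X F P ≤ F.card := by
    intro F P
    calc X F P ≤ ∑ Q ∈ F, 1 := by
          refine Finset.sum_le_sum fun Q _ ↦ ?_
          rw [ENNReal.ofReal_le_one]
          have hQ := Q.1.side_pos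
          have hP := P.1.side_pos
          have hQP := Q.1.centerDist_pos P.1
          calc Q.1.side ^ (d - η) * Q.1.centerDist P.1 ^ (-(a + d)) * P.1.side ^ (a + η) ≤
                Q.1.centerDist P.1 ^ (d - η) * Q.1.centerDist P.1 ^ (-(a + d)) *
                  Q.1.centerDist P.1 ^ (a + η) := by
                have h1 := Real.rpow_le_rpow hQ.le (Q.1.side_le_centerDist_left P.1)
                  (by linarith : 0 ≤ d - η)
                have h2 := Real.rpow_le_rpow hP.le (Q.1.side_le_centerDist_right P.1)
                  (by positivity : 0 ≤ a + η)
                gcongr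
            _ = 1 := by
                rw [← Real.rpow_add hQP, ← Real.rpow_add hQP]
                convert Real.rpow_zero _ using 2
                ring
      _ = F.card := by simp
  have hmain : ∀ F P, X F P ≤ ENNReal.ofReal C₁ + 2⁻¹ * ⨆ R, X F R := by
    intro F P
    have hP := P.1.side_pos
    have hterm : ∀ Q : W.Index, ENNReal.ofReal
        (Q.1.side ^ (d - η) * Q.1.centerDist P.1 ^ (-(a + d)) * P.1.side ^ (a + η)) ≤
        ENNReal.ofReal (P.1.side ^ a) *
          ENNReal.ofReal (Q.1.side ^ (d : ℝ) * Q.1.centerDist P.1 ^ (-(a + d))) +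
        ∑' R : W.Index, ENNReal.ofReal (8 * η * B ^ (a + d) * P.1.side ^ a *
            (R.1.side ^ (d : ℝ) * R.1.centerDist P.1 ^ (-(a + d)))) *
          ENNReal.ofReal
            (Q.1.side ^ (d - η) * Q.1.centerDist R.1 ^ (-(a + d)) * R.1.side ^ (a + η)) := by
      intro Q
      have hQ := Q.1.side_pos
      have hQP := Q.1.centerDist_pos P.1
      have hchain := hW.edist_le_tsum hε (A := fun R ↦ (R.1.side / Q.1.side) ^ η)
        (w := fun R ↦ ENNReal.ofReal (4 * η * (R.1.side / Q.1.side) ^ η)) (fun R S hRS ↦ by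
          have hR := R.1.side_pos
          have hS := S.1.side_pos
          rw [edist_dist, ← ENNReal.ofReal_add (by positivity) (by positivity), Real.dist_eq]
          refine ENNReal.ofReal_le_ofReal
            (abs_rpow_sub_rpow_le (by positivity) (by positivity) ?_ ?_ hη0 hη1)
          · rw [← mul_div_assoc]
            gcongr
            exact W.side_le_of_touch S.2 R.2 (by rwa [Set.inter_comm])
          · rw [← mul_div_assoc]
            gcongr
            exact W.side_le_of_touch R.2 S.2 hRS) Q P
      have hAP : ENNReal.ofReal ((P.1.side / Q.1.side) ^ η) ≤ 1 +
          edist ((Q.1.side / Q.1.side) ^ η) ((P.1.side / Q.1.side) ^ η) := by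
        rw [div_self hQ.ne', Real.one_rpow, edist_dist, ← ENNReal.ofReal_one,
          ← ENNReal.ofReal_add (by positivity) dist_nonneg]
        refine ENNReal.ofReal_le_ofReal ?_
        rw [Real.dist_eq]
        linarith [neg_abs_le (1 - (P.1.side / Q.1.side) ^ η)]
      have e1 : Q.1.side ^ (d - η) * Q.1.centerDist P.1 ^ (-(a + d)) * P.1.side ^ (a + η) =
          (P.1.side ^ a * (Q.1.side ^ (d : ℝ) * Q.1.centerDist P.1 ^ (-(a + d)))) *
            (P.1.side / Q.1.side) ^ η := by
        rw [Real.rpow_sub hQ, Real.rpow_add hP, Real.div_rpow hP.le hQ.le]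
        ring
      rw [e1, ENNReal.ofReal_mul (by positivity)]
      refine (mul_le_mul_right (hAP.trans (add_le_add_right hchain 1)) _).trans ?_
      rw [mul_add, mul_one, ENNReal.ofReal_mul (by positivity)]
      refine add_le_add_right ?_ _
      rw [← ENNReal.tsum_mul_left, ← ENNReal.tsum_mul_left]
      refine ENNReal.tsum_le_tsum fun R ↦ ?_
      split_ifs with hbet
      swap
      · simp
      have hR := R.1.side_pos
      have hQR := Q.1.centerDist_pos R.1
      have hRP := R.1.centerDist_pos P.1
      have h2 : (2 : ℝ≥0∞) = ENNReal.ofReal 2 := by simp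
      rw [h2, ← ENNReal.ofReal_mul (by positivity), ← ENNReal.ofReal_mul (by positivity),
        ← ENNReal.ofReal_mul (by positivity), ← ENNReal.ofReal_mul (by positivity)]
      refine ENNReal.ofReal_le_ofReal ?_
      have hk := hbet.rpow_neg_le hB (t := a + d) (by positivity)
      calc P.1.side ^ a * (Q.1.side ^ (d : ℝ) * Q.1.centerDist P.1 ^ (-(a + d))) *
            (2 * (4 * η * (R.1.side / Q.1.side) ^ η)) ≤
          P.1.side ^ a * (Q.1.side ^ (d : ℝ) * (B ^ (a + d) * (R.1.side ^ (a + d) *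
            Q.1.centerDist R.1 ^ (-(a + d)) * R.1.centerDist P.1 ^ (-(a + d))))) *
            (2 * (4 * η * (R.1.side / Q.1.side) ^ η)) := by gcongr
        _ = _ := by
          rw [Real.rpow_sub hQ, Real.rpow_add hR, Real.rpow_add hR, Real.div_rpow hR.le hQ.le]
          ring
    calc X F P ≤ ∑ Q ∈ F, _ := Finset.sum_le_sum fun Q _ ↦ hterm Q
      _ = ENNReal.ofReal (P.1.side ^ a) * ∑ Q ∈ F,
            ENNReal.ofReal (Q.1.side ^ (d : ℝ) * Q.1.centerDist P.1 ^ (-(a + d))) +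
          ∑' R : W.Index, ENNReal.ofReal (8 * η * B ^ (a + d) * P.1.side ^ a *
            (R.1.side ^ (d : ℝ) * R.1.centerDist P.1 ^ (-(a + d)))) * X F R := by
          rw [Finset.sum_add_distrib, ← Finset.mul_sum,
            ← Summable.tsum_finsetSum fun _ _ ↦ ENNReal.summable]
          simp_rw [← Finset.mul_sum]
          rfl
      _ ≤ ENNReal.ofReal (P.1.side ^ a) * ENNReal.ofReal (C₁ * P.1.side ^ (-a)) +
          ∑' R : W.Index, ENNReal.ofReal (8 * η * B ^ (a + d) * P.1.side ^ a *
            (R.1.side ^ (d : ℝ) * R.1.centerDist P.1 ^ (-(a + d)))) * ⨆ R, X F R := by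
          refine add_le_add ?_ ?_
          · gcongr
            exact (ENNReal.sum_le_tsum _).trans (hE Ω W P.1)
          · gcongr with R
            exact le_iSup (X F) R
      _ ≤ ENNReal.ofReal (P.1.side ^ a) * ENNReal.ofReal (C₁ * P.1.side ^ (-a)) +
          ENNReal.ofReal (8 * η * B ^ (a + d) * P.1.side ^ a) *
            ENNReal.ofReal (C₁ * P.1.side ^ (-a)) * ⨆ R, X F R := by
          rw [ENNReal.tsum_mul_right]
          have e2 : ∀ R : W.Index, ENNReal.ofReal (8 * η * B ^ (a + d) * P.1.side ^ a *
            (R.1.side ^ (d : ℝ) * R.1.centerDist P.1 ^ (-(a + d)))) =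
            ENNReal.ofReal (8 * η * B ^ (a + d) * P.1.side ^ a) * ENNReal.ofReal
            (R.1.side ^ (d : ℝ) * R.1.centerDist P.1 ^ (-(a + d))) := fun R ↦
              ENNReal.ofReal_mul (by positivity)
          simp_rw [e2]
          rw [ENNReal.tsum_mul_left]
          gcongr
          exact hE Ω W P.1
      _ ≤ _ := by
          rw [← ENNReal.ofReal_mul (by positivity), ← ENNReal.ofReal_mul (by positivity)]
          have e3 : P.1.side ^ a * P.1.side ^ (-a) = 1 := by
            rw [← Real.rpow_add hP, add_neg_cancel, Real.rpow_zero]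
          have e4 : P.1.side ^ a * (C₁ * P.1.side ^ (-a)) = C₁ := by
            rw [mul_left_comm, e3, mul_one]
          have e5 : 8 * η * B ^ (a + d) * P.1.side ^ a * (C₁ * P.1.side ^ (-a)) = η * K := by
            rw [mul_assoc, e4, hK]; ring
          rw [e4, e5]
          gcongr
          have h2 : (2⁻¹ : ℝ≥0∞) = ENNReal.ofReal 2⁻¹ := by
            rw [ENNReal.ofReal_inv_of_pos two_pos]; simp
          rw [h2]
          exact ENNReal.ofReal_le_ofReal hηK
  have hX : ∀ F, X F P₀ ≤ ENNReal.ofReal (2 * C₁) := by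
    intro F
    refine (le_iSup (X F) P₀).trans ?_
    have hfin : ⨆ R, X F R ≠ ⊤ :=
      ((iSup_le (hXF F)).trans_lt (ENNReal.natCast_lt_top _)).ne
    have := ENNReal.le_two_mul_of_le_add_half hfin (iSup_le (hmain F))
    rwa [ENNReal.ofReal_mul two_pos.le, ENNReal.ofReal_ofNat]
  have hP₀ := P₀.1.side_pos
  rw [ENNReal.tsum_eq_iSup_sum]
  refine iSup_le fun F ↦ ?_
  calc _ = ENNReal.ofReal (P₀.1.side ^ (-(a + η))) * X F P₀ := by
        rw [Finset.mul_sum]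
        refine Finset.sum_congr rfl fun Q _ ↦ ?_
        rw [← ENNReal.ofReal_mul (by positivity), mul_comm (P₀.1.side ^ _), mul_assoc,
          ← Real.rpow_add hP₀, add_neg_cancel, Real.rpow_zero, mul_one]
    _ ≤ ENNReal.ofReal (P₀.1.side ^ (-(a + η))) * ENNReal.ofReal (2 * C₁) := by
        gcongr; exact hX F
    _ = _ := by rw [← ENNReal.ofReal_mul (by positivity), mul_comm]

/-- A Schur test on sequences indexed by Whitney cubes of a uniform domain. -/
lemma exists_schur_bound (d : ℕ) (hd : 1 ≤ d) {ε : ℝ} (hε : 0 < ε) {a : ℝ} (ha : 0 < a) {r : ℝ}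
    (hr : 1 ≤ r) : ∃ C : ℝ, 0 < C ∧
      ∀ (Ω : Set (Fin d → ℝ)) (W : WhitneyCovering d Ω), IsUniformDomain W ε →
      ∀ α : W.Index → ℝ≥0∞,
      ∑' Q : W.Index, ENNReal.ofReal (Q.1.side ^ (d : ℝ)) * (∑' P : W.Index,
        ENNReal.ofReal (P.1.side ^ (a + d) * Q.1.centerDist P.1 ^ (-(a + d))) * α P) ^ r ≤
      ENNReal.ofReal C * ∑' P : W.Index, ENNReal.ofReal (P.1.side ^ (d : ℝ)) * α P ^ r := by
  obtain ⟨η₀, hη₀, C₂, hC₂, hneg⟩ := exists_tsum_negative_power_le d hd hε ha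
  have hr0 : 0 < r := by linarith
  have hr1 : 0 ≤ r - 1 := by linarith
  set κ := min a (η₀ / r) with hκ
  have hκ0 : 0 < κ := by positivity
  have hκa : κ ≤ a := min_le_left _ _
  have hκη : κ * (r - 1) ≤ η₀ := by
    have : κ * r ≤ η₀ := by
      rw [← le_div_iff₀ hr0]; exact min_le_right _ _
    linarith
  obtain ⟨C₁, hC₁, hE⟩ := WhitneyCovering.exists_tsum_centerDist_le d hκ0
  refine ⟨C₁ ^ (r - 1) * C₂, by positivity, fun Ω W hW α ↦ ?_⟩
  have hQ : ∀ Q : W.Index, (∑' P : W.Index,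
        ENNReal.ofReal (P.1.side ^ (a + d) * Q.1.centerDist P.1 ^ (-(a + d))) * α P) ^ r ≤
      ENNReal.ofReal (C₁ ^ (r - 1) * Q.1.side ^ (-(κ * (r - 1)))) * ∑' P : W.Index,
        ENNReal.ofReal (P.1.side ^ (a + d + κ * (r - 1)) * Q.1.centerDist P.1 ^ (-(a + d))) *
          α P ^ r := by
    intro Q
    have hQs := Q.1.side_pos
    have h := ENNReal.tsum_mul_rpow_le (fun P : W.Index ↦
      ENNReal.ofReal (P.1.side ^ (a + d - κ) * Q.1.centerDist P.1 ^ (-(a + d))))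
      (fun P ↦ ENNReal.ofReal (P.1.side ^ κ) * α P) hr
    have hsum : ∑' P : W.Index,
        ENNReal.ofReal (P.1.side ^ (a + d - κ) * Q.1.centerDist P.1 ^ (-(a + d))) ≤
        ENNReal.ofReal (C₁ * Q.1.side ^ (-κ)) := by
      refine le_trans (ENNReal.tsum_le_tsum fun P ↦ ENNReal.ofReal_le_ofReal ?_) (hE Ω W Q.1)
      have hP := P.1.side_pos
      have hQP := Q.1.centerDist_pos P.1
      rw [P.1.centerDist_comm Q.1]
      have h1 : P.1.side ^ (a + d - κ) = P.1.side ^ (d : ℝ) * P.1.side ^ (a - κ) := by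
        rw [← Real.rpow_add hP]; congr 1; ring
      have h2 : Q.1.centerDist P.1 ^ (-(κ + d)) =
          Q.1.centerDist P.1 ^ (a - κ) * Q.1.centerDist P.1 ^ (-(a + d)) := by
        rw [← Real.rpow_add hQP]; congr 1; ring
      have h3 := Real.rpow_le_rpow hP.le (Q.1.side_le_centerDist_right P.1)
        (by linarith : 0 ≤ a - κ)
      rw [h1, h2, mul_assoc]
      gcongr
    calc _ = (∑' P : W.Index,
          ENNReal.ofReal (P.1.side ^ (a + d - κ) * Q.1.centerDist P.1 ^ (-(a + d))) *
            (ENNReal.ofReal (P.1.side ^ κ) * α P)) ^ r := by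
          congr 1
          refine tsum_congr fun P ↦ ?_
          have hP := P.1.side_pos
          have hQP := Q.1.centerDist_pos P.1
          rw [← mul_assoc, ← ENNReal.ofReal_mul (by positivity),
            mul_right_comm (P.1.side ^ (a + d - κ)), ← Real.rpow_add hP, sub_add_cancel]
      _ ≤ _ := h
      _ ≤ ENNReal.ofReal (C₁ * Q.1.side ^ (-κ)) ^ (r - 1) * ∑' P : W.Index,
          ENNReal.ofReal (P.1.side ^ (a + d - κ) * Q.1.centerDist P.1 ^ (-(a + d))) *
            (ENNReal.ofReal (P.1.side ^ κ) * α P) ^ r := by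
          gcongr
      _ = _ := by
          congr 1
          · rw [ENNReal.ofReal_rpow_of_pos (by positivity), Real.mul_rpow hC₁.le (by positivity),
              ← Real.rpow_mul hQs.le, neg_mul]
          · refine tsum_congr fun P ↦ ?_
            have hP := P.1.side_pos
            have hQP := Q.1.centerDist_pos P.1
            rw [ENNReal.mul_rpow_of_nonneg _ _ hr0.le, ENNReal.ofReal_rpow_of_pos (by positivity),
              ← mul_assoc, ← ENNReal.ofReal_mul (by positivity),
              mul_right_comm (P.1.side ^ (a + d - κ)), ← Real.rpow_mul hP.le, ← Real.rpow_add hP]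
            congr 4
            ring
  calc _ ≤ ∑' Q : W.Index, ∑' P : W.Index, ENNReal.ofReal (C₁ ^ (r - 1) *
        P.1.side ^ (a + d + κ * (r - 1))) * α P ^ r * ENNReal.ofReal
          (Q.1.side ^ (d - κ * (r - 1)) * Q.1.centerDist P.1 ^ (-(a + d))) := by
        refine ENNReal.tsum_le_tsum fun Q ↦ ?_
        refine (mul_le_mul_right (hQ Q) _).trans (le_of_eq ?_)
        have hQs := Q.1.side_pos
        rw [← mul_assoc, ← ENNReal.ofReal_mul (by positivity), ← ENNReal.tsum_mul_left]
        refine tsum_congr fun P ↦ ?_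
        have hP := P.1.side_pos
        have hQP := Q.1.centerDist_pos P.1
        rw [← mul_assoc, ← ENNReal.ofReal_mul (by positivity),
          mul_right_comm (ENNReal.ofReal _), ← ENNReal.ofReal_mul (by positivity)]
        congr 2
        rw [sub_eq_add_neg (d : ℝ), Real.rpow_add hQs]
        ring
    _ = ∑' P : W.Index, ENNReal.ofReal (C₁ ^ (r - 1) * P.1.side ^ (a + d + κ * (r - 1))) *
          α P ^ r * ∑' Q : W.Index, ENNReal.ofReal
          (Q.1.side ^ (d - κ * (r - 1)) * Q.1.centerDist P.1 ^ (-(a + d))) := by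
        rw [ENNReal.tsum_comm]
        simp_rw [ENNReal.tsum_mul_left]
    _ ≤ ∑' P : W.Index, ENNReal.ofReal (C₁ ^ (r - 1) * P.1.side ^ (a + d + κ * (r - 1))) *
          α P ^ r * ENNReal.ofReal (C₂ * P.1.side ^ (-(a + κ * (r - 1)))) := by
        gcongr with P
        exact hneg _ (by positivity) hκη Ω W hW P
    _ = _ := by
        rw [← ENNReal.tsum_mul_left]
        refine tsum_congr fun P ↦ ?_
        have hP := P.1.side_pos
        rw [mul_right_comm, ← ENNReal.ofReal_mul (by positivity),
          ← mul_assoc (ENNReal.ofReal _) (ENNReal.ofReal _), ← ENNReal.ofReal_mul (by positivity)]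
        congr 2
        have e : P.1.side ^ (d : ℝ) =
            P.1.side ^ (a + d + κ * (r - 1)) * P.1.side ^ (-(a + κ * (r - 1))) := by
          rw [← Real.rpow_add hP]; congr 1; ring
        rw [e]; ring

lemma edist_average_rpow_le {α : Type*} [MeasurableSpace α] {μ : Measure α} [IsFiniteMeasure μ]
    (hμ : μ ≠ 0) {f : α → ℝ} (hf : Integrable f μ) (c : ℝ) {q : ℝ} (hq : 1 ≤ q) :
    edist c (⨍ y, f y ∂μ) ^ q ≤ (μ Set.univ)⁻¹ * ∫⁻ y, edist c (f y) ^ q ∂μ := by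
  have hq0 : 0 ≤ q := by linarith
  have h0 : μ Set.univ ≠ 0 := by simpa using hμ
  have ht : μ Set.univ ≠ ⊤ := measure_ne_top μ _
  have h1 : edist c (⨍ y, f y ∂μ) ≤ (μ Set.univ)⁻¹ * ∫⁻ y, edist c (f y) ∂μ := by
    have hne : NeZero μ := ⟨hμ⟩
    have e : c - ⨍ y, f y ∂μ = ∫ y, (c - f y) ∂((μ Set.univ)⁻¹ • μ) := by
      rw [average_eq', integral_sub (integrable_const c)
        (hf.smul_measure (ENNReal.inv_ne_top.2 h0)), integral_const, measureReal_def,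
        Measure.smul_apply, smul_eq_mul, smul_eq_mul, ENNReal.inv_mul_cancel h0 ht]
      simp
    rw [edist_eq_enorm_sub, e]
    refine (enorm_integral_le_lintegral_enorm _).trans ?_
    simp_rw [lintegral_smul_measure, edist_eq_enorm_sub]
    rfl
  calc edist c (⨍ y, f y ∂μ) ^ q ≤ ((μ Set.univ)⁻¹ * ∫⁻ y, edist c (f y) ∂μ) ^ q := by gcongr
    _ ≤ (μ Set.univ)⁻¹ ^ q * (μ Set.univ ^ (q - 1) * ∫⁻ y, edist c (f y) ^ q ∂μ) := by
        rw [ENNReal.mul_rpow_of_nonneg _ _ hq0]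
        gcongr
        exact lintegral_rpow_le_measure_univ_mul μ _ hq
    _ = _ := by
        rw [← mul_assoc, ENNReal.inv_rpow, ← ENNReal.rpow_neg, ← ENNReal.rpow_add _ _ h0 ht,
          ← ENNReal.rpow_neg_one]
        congr 2
        ring

section Energy

variable {d : ℕ}

/-- The integrand of the fractional seminorm. -/
noncomputable def diffQuotient (s q : ℝ) (f : (Fin d → ℝ) → ℝ) (x y : Fin d → ℝ) : ℝ≥0∞ :=
  (‖f x - f y‖₊ : ℝ≥0∞) ^ q / edist x y ^ (s * q + d)

/-- The inner integral at Whitney scale. -/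
noncomputable def whitneyEnergy (Ω : Set (Fin d → ℝ)) (s q : ℝ) (f : (Fin d → ℝ) → ℝ) (Q : Cube d)
    (x : Fin d → ℝ) : ℝ≥0∞ :=
  ∫⁻ y in Metric.closedBall Q.center (5 * Q.side / 2) ∩ Ω, diffQuotient s q f x y

/-- The mean over a cube of the inner integral at Whitney scale. -/
noncomputable def meanEnergy (Ω : Set (Fin d → ℝ)) (s q : ℝ) (f : (Fin d → ℝ) → ℝ) (Q : Cube d) :
    ℝ≥0∞ :=
  (volume Q.toSet)⁻¹ * ∫⁻ x in Q.toSet, whitneyEnergy Ω s q f Q x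

variable {Ω : Set (Fin d → ℝ)} {s q : ℝ} {f : (Fin d → ℝ) → ℝ}

lemma diffQuotient_eq (s q : ℝ) (f : (Fin d → ℝ) → ℝ) (x y : Fin d → ℝ) :
    diffQuotient s q f x y = edist (f x) (f y) ^ q / edist x y ^ (s * q + d) := by
  rw [edist_eq_enorm_sub]; rfl

lemma edist_rpow_le_mul_diffQuotient (hs : 0 < s) (hq : 1 ≤ q) {x y : Fin d → ℝ} {L : ℝ}
    (h : dist x y ≤ L) :
    edist (f x) (f y) ^ q ≤ ENNReal.ofReal (L ^ (s * q + d)) * diffQuotient s q f x y := by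
  have hq0 : 0 < q := by linarith
  have ht : 0 < s * q + d := by positivity
  rcases eq_or_ne x y with rfl | hxy
  · simp [ENNReal.zero_rpow_of_pos hq0]
  have hL : 0 ≤ L := dist_nonneg.trans h
  have h0 : edist x y ^ (s * q + d) ≠ 0 := by
    simp [ENNReal.rpow_eq_zero_iff, hxy, ht, not_lt.2 ht.le]
  have h1 : edist x y ^ (s * q + d) ≠ ⊤ := ENNReal.rpow_ne_top_of_nonneg ht.le (edist_ne_top x y)
  calc edist (f x) (f y) ^ q = edist x y ^ (s * q + d) * diffQuotient s q f x y := by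
        rw [diffQuotient_eq, ENNReal.mul_div_cancel h0 h1]
    _ ≤ _ := by
        rw [← ENNReal.ofReal_rpow_of_nonneg hL ht.le, edist_dist]
        gcongr

lemma diffQuotient_le_of_le_dist (hs : 0 < s) (hq : 1 ≤ q) {x y : Fin d → ℝ} {L : ℝ} (hL : 0 < L)
    (h : L ≤ dist x y) :
    diffQuotient s q f x y ≤ ENNReal.ofReal (L ^ (-(s * q + d))) * edist (f x) (f y) ^ q := by
  have ht : 0 < s * q + d := by positivity
  rw [diffQuotient_eq, ENNReal.div_eq_inv_mul, ← ENNReal.ofReal_rpow_of_pos hL, ENNReal.rpow_neg,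
    edist_dist]
  gcongr

/-- The constant in the estimate of oscillations on Whitney cubes. -/
noncomputable def oscConst (d : ℕ) (s q : ℝ) : ℝ := 5 ^ (d : ℝ) * 2 ^ (s * q + d)

lemma oscConst_pos (d : ℕ) (s q : ℝ) : 0 < oscConst d s q := by
  unfold oscConst; positivity

lemma WhitneyCovering.edist_setAverage_rpow_le (W : WhitneyCovering d Ω) (hs : 0 < s) (hq : 1 ≤ q)
    {R S : Cube d} (hR : R ∈ W.cubes) (hS : S ∈ W.cubes) (hf : IntegrableOn f S.toSet)
    (htouch : (R.toSet ∩ S.toSet).Nonempty) (hle : S.side ≤ R.side) {x : Fin d → ℝ}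
    (hx : x ∈ R.toSet) : edist (f x) (⨍ y in S.toSet, f y) ^ q ≤
      ENNReal.ofReal (oscConst d s q * R.side ^ (s * q)) * whitneyEnergy Ω s q f R x := by
  have hRs := R.side_pos
  have hSs := S.side_pos
  have h5 : R.side ≤ 5 * S.side := W.side_le_of_touch hS hR (Set.inter_comm _ _ ▸ htouch)
  obtain ⟨z, hzR, hzS⟩ := htouch
  have : IsFiniteMeasure (volume.restrict S.toSet) :=
    isFiniteMeasure_restrict.2 S.volume_toSet_ne_top
  have hne : volume.restrict S.toSet ≠ 0 := by
    simpa [Measure.restrict_eq_zero] using S.volume_toSet_ne_zero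
  have hyz : ∀ y ∈ S.toSet, dist y z ≤ S.side := fun y hy ↦ by
    have h1 := Cube.dist_center_le hy
    have h2 := Cube.dist_center_le hzS
    have h3 := dist_triangle_right y z S.center
    linarith
  have hzx : dist z R.center ≤ R.side / 2 := Cube.dist_center_le hzR
  have hsub : S.toSet ⊆ Metric.closedBall R.center (5 * R.side / 2) ∩ Ω := fun y hy ↦ by
    refine ⟨?_, W.toSet_subset hS hy⟩
    have h1 := hyz y hy
    have h2 := dist_triangle y z R.center
    rw [Metric.mem_closedBall]
    linarith
  have hdist : ∀ y ∈ S.toSet, dist x y ≤ 2 * R.side := fun y hy ↦ by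
    have h1 := hyz y hy
    have h2 := Cube.dist_center_le hx
    have h3 := dist_triangle_right x z R.center
    have h4 := dist_triangle_right x y z
    linarith
  refine (edist_average_rpow_le hne hf (f x) hq).trans ?_
  rw [Measure.restrict_apply_univ]
  calc (volume S.toSet)⁻¹ * ∫⁻ y in S.toSet, edist (f x) (f y) ^ q ≤
      ENNReal.ofReal ((S.side ^ (d : ℝ))⁻¹) * (ENNReal.ofReal ((2 * R.side) ^ (s * q + d)) *
        whitneyEnergy Ω s q f R x) := by
        rw [S.volume_toSet, ENNReal.ofReal_inv_of_pos (by positivity), whitneyEnergy,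
          ← lintegral_const_mul' _ _ ENNReal.ofReal_ne_top]
        gcongr _ * ?_
        refine (setLIntegral_mono' S.measurableSet_toSet fun y hy ↦
          edist_rpow_le_mul_diffQuotient hs hq (hdist y hy)).trans ?_
        exact lintegral_mono_set hsub
    _ ≤ _ := by
        rw [← mul_assoc, ← ENNReal.ofReal_mul (by positivity)]
        gcongr ENNReal.ofReal ?_ * _
        have h6 : R.side ^ (d : ℝ) ≤ 5 ^ (d : ℝ) * S.side ^ (d : ℝ) := by
          rw [← Real.mul_rpow (by norm_num) hSs.le]
          gcongr
        rw [inv_mul_le_iff₀ (by positivity), Real.mul_rpow (by norm_num) hRs.le,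
          Real.rpow_add hRs, oscConst]
        calc _ = 2 ^ (s * q + d) * R.side ^ (s * q) * R.side ^ (d : ℝ) := by ring
          _ ≤ 2 ^ (s * q + d) * R.side ^ (s * q) * (5 ^ (d : ℝ) * S.side ^ (d : ℝ)) := by gcongr
          _ = _ := by ring

lemma volume_mul_meanEnergy (Q : Cube d) : volume Q.toSet * meanEnergy Ω s q f Q =
    ∫⁻ x in Q.toSet, whitneyEnergy Ω s q f Q x := by
  rw [meanEnergy, ← mul_assoc, ENNReal.mul_inv_cancel Q.volume_toSet_ne_zero
    Q.volume_toSet_ne_top, one_mul]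

lemma WhitneyCovering.edist_setAverage_setAverage_le (W : WhitneyCovering d Ω) (hs : 0 < s)
    (hq : 1 ≤ q) (hf : ∀ Q ∈ W.cubes, IntegrableOn f Q.toSet)
    {R S : Cube d} (hR : R ∈ W.cubes) (hS : S ∈ W.cubes)
    (htouch : (R.toSet ∩ S.toSet).Nonempty) (hle : S.side ≤ R.side) :
    edist (⨍ y in S.toSet, f y) (⨍ y in R.toSet, f y) ≤
      ENNReal.ofReal (oscConst d s q ^ (1 / q)) *
        (ENNReal.ofReal (R.side ^ s) * meanEnergy Ω s q f R ^ (1 / q)) := by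
  have hq0 : 0 < q := by linarith
  have hRs := R.side_pos
  have hc := oscConst_pos d s q
  have : IsFiniteMeasure (volume.restrict R.toSet) :=
    isFiniteMeasure_restrict.2 R.volume_toSet_ne_top
  have hne : volume.restrict R.toSet ≠ 0 := by
    simpa [Measure.restrict_eq_zero] using R.volume_toSet_ne_zero
  rw [← ENNReal.rpow_le_rpow_iff hq0]
  refine (edist_average_rpow_le hne (hf R hR) _ hq).trans ?_
  rw [Measure.restrict_apply_univ]
  calc (volume R.toSet)⁻¹ * ∫⁻ x in R.toSet, edist (⨍ y in S.toSet, f y) (f x) ^ q ≤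
      (volume R.toSet)⁻¹ * ∫⁻ x in R.toSet,
        ENNReal.ofReal (oscConst d s q * R.side ^ (s * q)) * whitneyEnergy Ω s q f R x := by
        gcongr _ * ?_
        refine setLIntegral_mono' R.measurableSet_toSet fun x hx ↦ ?_
        rw [edist_comm]
        exact W.edist_setAverage_rpow_le hs hq hR hS (hf S hS) htouch hle hx
    _ = _ := by
        rw [lintegral_const_mul' _ _ ENNReal.ofReal_ne_top, mul_left_comm, ← meanEnergy,
          ENNReal.mul_rpow_of_nonneg _ _ hq0.le, ENNReal.mul_rpow_of_nonneg _ _ hq0.le,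
          ENNReal.ofReal_rpow_of_nonneg (by positivity) hq0.le,
          ENNReal.ofReal_rpow_of_nonneg (by positivity) hq0.le, ← Real.rpow_mul hc.le,
          ← Real.rpow_mul hRs.le, ← ENNReal.rpow_mul, one_div_mul_cancel hq0.ne', Real.rpow_one,
          ENNReal.rpow_one, ENNReal.ofReal_mul hc.le, mul_assoc]

end Energy

open scoped Classical in
lemma exists_edist_setAverage_rpow_le (d : ℕ) {ε s q : ℝ} (hε : 0 < ε) (hs : 0 < s) (hq : 1 ≤ q) :
    ∃ C : ℝ, 0 < C ∧ ∀ (Ω : Set (Fin d → ℝ)) (W : WhitneyCovering d Ω), IsUniformDomain W ε →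
      ∀ f : (Fin d → ℝ) → ℝ, (∀ Q ∈ W.cubes, IntegrableOn f Q.toSet) → ∀ Q S : W.Index,
      edist (⨍ y in Q.1.toSet, f y) (⨍ y in S.1.toSet, f y) ^ q ≤
        ENNReal.ofReal (C * Q.1.centerDist S.1 ^ (s * (q - 1))) * ∑' P : W.Index,
          if Cube.Between (chainConst ε) Q.1 P.1 S.1 then
            ENNReal.ofReal (P.1.side ^ s) * meanEnergy Ω s q f P.1 else 0 := by
  have hq0 : 0 < q := by linarith
  have hq1 : 0 ≤ q - 1 := by linarith
  obtain ⟨C, hC, h⟩ := exists_tsum_between_le d hs (chainConst_pos hε)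
  have hc := oscConst_pos d s q
  refine ⟨2 ^ q * oscConst d s q * C ^ (q - 1), by positivity, fun Ω W hW f hf Q S ↦ ?_⟩
  have hQS := Q.1.centerDist_pos S.1
  have hchain := hW.edist_le_tsum hε (A := fun R ↦ ⨍ y in R.1.toSet, f y)
    (w := fun R ↦ ENNReal.ofReal (oscConst d s q ^ (1 / q)) *
        (ENNReal.ofReal (R.1.side ^ s) * meanEnergy Ω s q f R.1 ^ (1 / q))) (fun R S hRS ↦ by
      rcases le_total R.1.side S.1.side with hle | hle
      · exact (W.edist_setAverage_setAverage_le hs hq hf S.2 R.2 (Set.inter_comm _ _ ▸ hRS)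
          hle).trans le_add_self
      · rw [edist_comm]
        exact (W.edist_setAverage_setAverage_le hs hq hf R.2 S.2 hRS hle).trans le_self_add) Q S
  set m : W.Index → ℝ≥0∞ := fun R ↦ if Cube.Between (chainConst ε) Q.1 R.1 S.1 then
    ENNReal.ofReal (R.1.side ^ s) else 0 with hm
  have e : ∀ R : W.Index, (if Cube.Between (chainConst ε) Q.1 R.1 S.1 then
      ENNReal.ofReal (oscConst d s q ^ (1 / q)) *
        (ENNReal.ofReal (R.1.side ^ s) * meanEnergy Ω s q f R.1 ^ (1 / q)) else 0) =
      ENNReal.ofReal (oscConst d s q ^ (1 / q)) * (m R * meanEnergy Ω s q f R.1 ^ (1 / q)) := by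
    intro R
    simp only [hm]
    split_ifs <;> simp
  simp_rw [e] at hchain
  rw [ENNReal.tsum_mul_left, ← mul_assoc] at hchain
  have hsum : ∑' R, m R ≤ ENNReal.ofReal (C * Q.1.centerDist S.1 ^ s) := h Ω W Q.1 S.1
  calc edist (⨍ y in Q.1.toSet, f y) (⨍ y in S.1.toSet, f y) ^ q ≤
      (2 * ENNReal.ofReal (oscConst d s q ^ (1 / q)) *
        ∑' R, m R * meanEnergy Ω s q f R.1 ^ (1 / q)) ^ q := by gcongr
    _ ≤ (2 * ENNReal.ofReal (oscConst d s q ^ (1 / q))) ^ q *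
        (ENNReal.ofReal (C * Q.1.centerDist S.1 ^ s) ^ (q - 1) *
          ∑' R, m R * (meanEnergy Ω s q f R.1 ^ (1 / q)) ^ q) := by
        rw [ENNReal.mul_rpow_of_nonneg _ _ hq0.le]
        gcongr
        refine (ENNReal.tsum_mul_rpow_le m _ hq).trans ?_
        gcongr
    _ = _ := by
        rw [← mul_assoc]
        congr 1
        · rw [show (2 : ℝ≥0∞) = ENNReal.ofReal 2 by simp, ← ENNReal.ofReal_mul (by norm_num),
            ENNReal.ofReal_rpow_of_nonneg (by positivity) hq0.le,
            ENNReal.ofReal_rpow_of_nonneg (by positivity) hq1,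
            ← ENNReal.ofReal_mul (by positivity), Real.mul_rpow (by norm_num) (by positivity),
            Real.mul_rpow hC.le (by positivity), ← Real.rpow_mul hc.le, ← Real.rpow_mul hQS.le,
            one_div_mul_cancel hq0.ne', Real.rpow_one]
          congr 1
          ring
        · refine tsum_congr fun R ↦ ?_
          rw [← ENNReal.rpow_mul, one_div_mul_cancel hq0.ne', ENNReal.rpow_one]
          simp only [hm]
          split_ifs <;> simp

/-- The potential controlling the part of the seminorm away from the Whitney cube. -/
noncomputable def tailEnergy {d : ℕ} {Ω : Set (Fin d → ℝ)} (W : WhitneyCovering d Ω) (s q : ℝ)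
    (f : (Fin d → ℝ) → ℝ) (Q : Cube d) : ℝ≥0∞ :=
  ∑' P : W.Index, ENNReal.ofReal (P.1.side ^ (s + d) * Q.centerDist P.1 ^ (-(s + d))) *
    meanEnergy Ω s q f P.1

open scoped Classical in
lemma exists_tsum_tsum_between_le (d : ℕ) {ε s : ℝ} (hε : 0 < ε) (hs : 0 < s) (q : ℝ) :
    ∃ C : ℝ, 0 < C ∧ ∀ (Ω : Set (Fin d → ℝ)) (W : WhitneyCovering d Ω)
      (f : (Fin d → ℝ) → ℝ) (Q : Cube d),
      ∑' S : W.Index, ENNReal.ofReal (S.1.side ^ (d : ℝ) * Q.centerDist S.1 ^ (-(s + d))) *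
        ∑' P : W.Index, (if Cube.Between (chainConst ε) Q P.1 S.1 then
          ENNReal.ofReal (P.1.side ^ s) * meanEnergy Ω s q f P.1 else 0) ≤
      ENNReal.ofReal C * tailEnergy W s q f Q := by
  obtain ⟨C, hC, h⟩ := WhitneyCovering.exists_tsum_centerDist_le d hs
  have hB := chainConst_pos hε
  refine ⟨chainConst ε ^ (s + d) * C, by positivity, fun Ω W f Q ↦ ?_⟩
  simp_rw [← ENNReal.tsum_mul_left]
  rw [ENNReal.tsum_comm, tailEnergy, ← ENNReal.tsum_mul_left]
  refine ENNReal.tsum_le_tsum fun P ↦ ?_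
  have hP := P.1.side_pos
  have hQP := Q.centerDist_pos P.1
  calc ∑' S : W.Index, ENNReal.ofReal (S.1.side ^ (d : ℝ) * Q.centerDist S.1 ^ (-(s + d))) *
        (if Cube.Between (chainConst ε) Q P.1 S.1 then
          ENNReal.ofReal (P.1.side ^ s) * meanEnergy Ω s q f P.1 else 0) ≤
      ∑' S : W.Index, ENNReal.ofReal (S.1.side ^ (d : ℝ) * S.1.centerDist P.1 ^ (-(s + d))) *
        (ENNReal.ofReal (chainConst ε ^ (s + d) * P.1.side ^ (s + d) *
          Q.centerDist P.1 ^ (-(s + d)) * P.1.side ^ s) * meanEnergy Ω s q f P.1) := by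
        refine ENNReal.tsum_le_tsum fun S ↦ ?_
        split_ifs with hbet
        · have hS := S.1.side_pos
          have hQS := Q.centerDist_pos S.1
          have hSP := S.1.centerDist_pos P.1
          rw [← mul_assoc, ← mul_assoc, ← ENNReal.ofReal_mul (by positivity),
            ← ENNReal.ofReal_mul (by positivity)]
          gcongr ENNReal.ofReal ?_ * _
          have h1 := hbet.rpow_neg_le hB (t := s + d) (by positivity)
          rw [P.1.centerDist_comm S.1] at h1
          calc _ ≤ S.1.side ^ (d : ℝ) * (chainConst ε ^ (s + d) * (P.1.side ^ (s + d) *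
                Q.centerDist P.1 ^ (-(s + d)) * S.1.centerDist P.1 ^ (-(s + d)))) *
                  P.1.side ^ s := by gcongr
            _ = _ := by ring
        · simp
    _ ≤ ENNReal.ofReal (C * P.1.side ^ (-s)) *
        (ENNReal.ofReal (chainConst ε ^ (s + d) * P.1.side ^ (s + d) *
          Q.centerDist P.1 ^ (-(s + d)) * P.1.side ^ s) * meanEnergy Ω s q f P.1) := by
        rw [ENNReal.tsum_mul_right]
        gcongr
        exact h Ω W P.1
    _ = _ := by
        rw [← mul_assoc, ← mul_assoc, ← ENNReal.ofReal_mul (by positivity),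
          ← ENNReal.ofReal_mul (by positivity)]
        congr 2
        have e : P.1.side ^ (-s) * P.1.side ^ s = 1 := by
          rw [← Real.rpow_add hP]; simp
        linear_combination (C * chainConst ε ^ (s + d) * P.1.side ^ (s + d) *
          Q.centerDist P.1 ^ (-(s + d))) * e

lemma edist_rpow_le_four_mul {q : ℝ} (hq : 1 ≤ q) (a b c e : ℝ) :
    edist a e ^ q ≤ ENNReal.ofReal (4 ^ (q - 1)) *
      (edist a b ^ q + edist b c ^ q + edist e c ^ q) := by
  have hq1 : 0 ≤ q - 1 := by linarith
  have h2 : (2 : ℝ≥0∞) ^ (q - 1) * 2 ^ (q - 1) = ENNReal.ofReal (4 ^ (q - 1)) := by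
    rw [← ENNReal.mul_rpow_of_nonneg _ _ hq1, ← ENNReal.ofReal_rpow_of_pos (by norm_num)]
    norm_num
  have h1 : (1 : ℝ≥0∞) ≤ 2 ^ (q - 1) := by
    simpa using ENNReal.rpow_le_rpow one_le_two hq1
  calc edist a e ^ q ≤ (edist a b + edist b c + edist e c) ^ q := by
        gcongr
        rw [edist_comm e c]
        exact edist_triangle4 a b c e
    _ ≤ 2 ^ (q - 1) * ((edist a b + edist b c) ^ q + edist e c ^ q) :=
        ENNReal.rpow_add_le_mul_rpow_add_rpow _ _ hq
    _ ≤ 2 ^ (q - 1) * (2 ^ (q - 1) * (edist a b ^ q + edist b c ^ q) +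
          2 ^ (q - 1) * edist e c ^ q) := by
        gcongr
        · exact ENNReal.rpow_add_le_mul_rpow_add_rpow _ _ hq
        · exact le_mul_of_one_le_left zero_le h1
    _ = _ := by rw [← mul_add, ← mul_assoc, h2]

lemma WhitneyCovering.setLIntegral_diffQuotient_le {d : ℕ} {Ω : Set (Fin d → ℝ)}
    (W : WhitneyCovering d Ω) {s q : ℝ} (hs : 0 < s) (hq : 1 ≤ q) {f : (Fin d → ℝ) → ℝ}
    (hf : ∀ Q ∈ W.cubes, IntegrableOn f Q.toSet) (Q S : W.Index) {x : Fin d → ℝ}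
    (hx : x ∈ Q.1.toSet) :
    ∫⁻ y in S.1.toSet \ Metric.closedBall Q.1.center (5 * Q.1.side / 2), diffQuotient s q f x y ≤
      ENNReal.ofReal (7 ^ (s * q + d) * 4 ^ (q - 1) *
        (S.1.side ^ (d : ℝ) * Q.1.centerDist S.1 ^ (-(s * q + d)))) *
      (ENNReal.ofReal (oscConst d s q * Q.1.side ^ (s * q)) * whitneyEnergy Ω s q f Q.1 x +
        edist (⨍ y in Q.1.toSet, f y) (⨍ y in S.1.toSet, f y) ^ q +
        ENNReal.ofReal (oscConst d s q * S.1.side ^ (s * q)) * meanEnergy Ω s q f S.1) := by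
  have hQS := Q.1.centerDist_pos S.1
  have hSs := S.1.side_pos
  have hself : ∀ R : W.Index, (R.1.toSet ∩ R.1.toSet).Nonempty := fun R ↦
    ⟨_, R.1.center_mem_toSet, R.1.center_mem_toSet⟩
  set X := ENNReal.ofReal (oscConst d s q * Q.1.side ^ (s * q)) * whitneyEnergy Ω s q f Q.1 x
  set Y := edist (⨍ y in Q.1.toSet, f y) (⨍ y in S.1.toSet, f y) ^ q
  have hpt : ∀ y ∈ S.1.toSet \ Metric.closedBall Q.1.center (5 * Q.1.side / 2),
      diffQuotient s q f x y ≤ ENNReal.ofReal ((Q.1.centerDist S.1 / 7) ^ (-(s * q + d)) *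
        4 ^ (q - 1)) * (X + Y +
          ENNReal.ofReal (oscConst d s q * S.1.side ^ (s * q)) * whitneyEnergy Ω s q f S.1 y) := by
    intro y hy
    have hfar := W.centerDist_le_of_far Q.2 S.2 hx hy.1 hy.2
    refine (diffQuotient_le_of_le_dist hs hq (L := Q.1.centerDist S.1 / 7) (by positivity)
      (by linarith)).trans ?_
    rw [ENNReal.ofReal_mul (by positivity), mul_assoc]
    gcongr
    refine (edist_rpow_le_four_mul hq _ (⨍ y in Q.1.toSet, f y)
      (⨍ y in S.1.toSet, f y) _).trans ?_
    gcongr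
    · exact W.edist_setAverage_rpow_le hs hq Q.2 Q.2 (hf _ Q.2) (hself Q) le_rfl hx
    · exact W.edist_setAverage_rpow_le hs hq S.2 S.2 (hf _ S.2) (hself S) le_rfl hy.1
  calc _ ≤ ∫⁻ y in S.1.toSet \ Metric.closedBall Q.1.center (5 * Q.1.side / 2),
        ENNReal.ofReal ((Q.1.centerDist S.1 / 7) ^ (-(s * q + d)) *
        4 ^ (q - 1)) * (X + Y +
          ENNReal.ofReal (oscConst d s q * S.1.side ^ (s * q)) * whitneyEnergy Ω s q f S.1 y) :=
        setLIntegral_mono' (S.1.measurableSet_toSet.diff Metric.isClosed_closedBall.measurableSet)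
          hpt
    _ ≤ ∫⁻ y in S.1.toSet,
        ENNReal.ofReal ((Q.1.centerDist S.1 / 7) ^ (-(s * q + d)) *
        4 ^ (q - 1)) * (X + Y +
          ENNReal.ofReal (oscConst d s q * S.1.side ^ (s * q)) * whitneyEnergy Ω s q f S.1 y) :=
        lintegral_mono_set Set.sdiff_subset
    _ = _ := by
        rw [lintegral_const_mul' _ _ ENNReal.ofReal_ne_top, lintegral_add_left measurable_const,
          setLIntegral_const, lintegral_const_mul' _ _ ENNReal.ofReal_ne_top,
          ← volume_mul_meanEnergy, mul_left_comm _ (volume S.1.toSet), mul_comm (X + Y),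
          ← mul_add, ← mul_assoc, S.1.volume_toSet, ← ENNReal.ofReal_mul (by positivity)]
        congr 2
        rw [Real.div_rpow hQS.le (by norm_num), Real.rpow_neg (by norm_num : (0 : ℝ) ≤ 7),
          div_inv_eq_mul]
        ring

lemma exists_setLIntegral_diffQuotient_le (d : ℕ) {ε s q : ℝ} (hε : 0 < ε) (hs : 0 < s)
    (hq : 1 ≤ q) : ∃ C : ℝ, 0 < C ∧ ∀ (Ω : Set (Fin d → ℝ)) (W : WhitneyCovering d Ω),
      IsUniformDomain W ε → ∀ f : (Fin d → ℝ) → ℝ, (∀ Q ∈ W.cubes, IntegrableOn f Q.toSet) →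
      ∀ Q : W.Index, ∀ x ∈ Q.1.toSet, ∫⁻ y in Ω, diffQuotient s q f x y ≤
        ENNReal.ofReal C * (whitneyEnergy Ω s q f Q.1 x + tailEnergy W s q f Q.1) := by
  classical
  have hq0 : 0 < q := by linarith
  have hsq : 0 < s * q := by positivity
  obtain ⟨C₁, hC₁, h₁⟩ := WhitneyCovering.exists_tsum_centerDist_le d hsq
  obtain ⟨C₂, hC₂, h₂⟩ := exists_edist_setAverage_rpow_le d hε hs hq
  obtain ⟨C₃, hC₃, h₃⟩ := exists_tsum_tsum_between_le d hε hs q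
  have hc := oscConst_pos d s q
  set K : ℝ := 7 ^ (s * q + d) * 4 ^ (q - 1)
  have hK0 : 0 < K := by positivity
  set c := oscConst d s q
  refine ⟨1 + K * (c * C₁ + C₂ * C₃ + c), by positivity, fun Ω W hW f hf Q x hx ↦ ?_⟩
  have hQ := Q.1.side_pos
  set Φ := whitneyEnergy Ω s q f Q.1 x
  set G := tailEnergy W s q f Q.1 with hG
  set D := Q.1.centerDist
  have hD : ∀ S, 0 < D S := Q.1.centerDist_pos
  have hcover : Ω ⊆ (Metric.closedBall Q.1.center (5 * Q.1.side / 2) ∩ Ω) ∪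
      ⋃ S : W.Index, S.1.toSet \ Metric.closedBall Q.1.center (5 * Q.1.side / 2) := by
    intro y hy
    by_cases hyQ : y ∈ Metric.closedBall Q.1.center (5 * Q.1.side / 2)
    · exact Or.inl ⟨hyQ, hy⟩
    · rw [← W.iUnion_toSet, Set.mem_iUnion] at hy
      obtain ⟨S, hS⟩ := hy
      exact Or.inr (Set.mem_iUnion.2 ⟨S, hS, hyQ⟩)
  have hT₁ : ∑' S : W.Index, ENNReal.ofReal (S.1.side ^ (d : ℝ) * D S.1 ^ (-(s * q + d))) *
      (ENNReal.ofReal (c * Q.1.side ^ (s * q)) * Φ) ≤ ENNReal.ofReal (c * C₁) * Φ := by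
    rw [ENNReal.tsum_mul_right]
    have h := h₁ Ω W Q.1
    simp_rw [fun S : W.Index ↦ S.1.centerDist_comm Q.1] at h
    refine (mul_le_mul_left h _).trans (le_of_eq ?_)
    rw [← mul_assoc, ← ENNReal.ofReal_mul (by positivity)]
    congr 2
    have e : Q.1.side ^ (-(s * q)) * Q.1.side ^ (s * q) = 1 := by
      rw [← Real.rpow_add hQ]; simp
    linear_combination (c * C₁) * e
  have hT₂ : ∑' S : W.Index, ENNReal.ofReal (S.1.side ^ (d : ℝ) * D S.1 ^ (-(s * q + d))) *
      edist (⨍ y in Q.1.toSet, f y) (⨍ y in S.1.toSet, f y) ^ q ≤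
      ENNReal.ofReal (C₂ * C₃) * G := by
    rw [ENNReal.ofReal_mul hC₂.le, mul_assoc]
    refine le_trans ?_ (mul_le_mul_right (h₃ Ω W f Q.1) _)
    rw [← ENNReal.tsum_mul_left]
    refine ENNReal.tsum_le_tsum fun S ↦ (mul_le_mul_right (h₂ Ω W hW f hf Q S) _).trans
      (le_of_eq ?_)
    have hS := S.1.side_pos
    have hDS := hD S.1
    rw [← mul_assoc, ← mul_assoc, ← ENNReal.ofReal_mul (by positivity),
      ← ENNReal.ofReal_mul (by positivity)]
    congr 2
    have e : D S.1 ^ (-(s + d)) = D S.1 ^ (-(s * q + d)) * D S.1 ^ (s * (q - 1)) := by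
      rw [← Real.rpow_add hDS]; congr 1; ring
    change _ = C₂ * (S.1.side ^ (d : ℝ) * D S.1 ^ (-(s + d)))
    rw [e]
    ring
  have hT₃ : ∑' S : W.Index, ENNReal.ofReal (S.1.side ^ (d : ℝ) * D S.1 ^ (-(s * q + d))) *
      (ENNReal.ofReal (c * S.1.side ^ (s * q)) * meanEnergy Ω s q f S.1) ≤
      ENNReal.ofReal c * G := by
    rw [hG, tailEnergy, ← ENNReal.tsum_mul_left]
    refine ENNReal.tsum_le_tsum fun S ↦ ?_
    have hS := S.1.side_pos
    have hDS := hD S.1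
    rw [← mul_assoc, ← mul_assoc, ← ENNReal.ofReal_mul (by positivity),
      ← ENNReal.ofReal_mul (by positivity)]
    gcongr ENNReal.ofReal ?_ * _
    have e₁ : S.1.side ^ (d : ℝ) * S.1.side ^ (s * q) =
        S.1.side ^ (s * (q - 1)) * S.1.side ^ (s + d) := by
      rw [← Real.rpow_add hS, ← Real.rpow_add hS]; congr 1; ring
    have e₂ : D S.1 ^ (-(s + d)) = D S.1 ^ (s * (q - 1)) * D S.1 ^ (-(s * q + d)) := by
      rw [← Real.rpow_add hDS]; congr 1; ring
    have h := Real.rpow_le_rpow hS.le (Q.1.side_le_centerDist_right S.1)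
      (mul_nonneg hs.le (by linarith) : 0 ≤ s * (q - 1))
    calc _ = c * (S.1.side ^ (s * (q - 1)) * S.1.side ^ (s + d)) * D S.1 ^ (-(s * q + d)) := by
          rw [← e₁]; ring
      _ ≤ c * (D S.1 ^ (s * (q - 1)) * S.1.side ^ (s + d)) * D S.1 ^ (-(s * q + d)) := by gcongr
      _ = c * (S.1.side ^ (s + d) * D S.1 ^ (-(s + d))) := by rw [e₂]; ring
  calc ∫⁻ y in Ω, diffQuotient s q f x y ≤ Φ + ∑' S : W.Index,
        ∫⁻ y in S.1.toSet \ Metric.closedBall Q.1.center (5 * Q.1.side / 2),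
          diffQuotient s q f x y := by
        refine (lintegral_mono_set hcover).trans ((lintegral_union_le _ _ _).trans ?_)
        gcongr
        · exact le_rfl
        · exact lintegral_iUnion_le _ _
    _ ≤ Φ + ∑' S : W.Index, ENNReal.ofReal K *
        (ENNReal.ofReal (S.1.side ^ (d : ℝ) * D S.1 ^ (-(s * q + d))) *
            (ENNReal.ofReal (c * Q.1.side ^ (s * q)) * Φ) +
          ENNReal.ofReal (S.1.side ^ (d : ℝ) * D S.1 ^ (-(s * q + d))) *
            edist (⨍ y in Q.1.toSet, f y) (⨍ y in S.1.toSet, f y) ^ q +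
          ENNReal.ofReal (S.1.side ^ (d : ℝ) * D S.1 ^ (-(s * q + d))) *
            (ENNReal.ofReal (c * S.1.side ^ (s * q)) * meanEnergy Ω s q f S.1)) := by
        gcongr with S
        refine (W.setLIntegral_diffQuotient_le hs hq hf Q S hx).trans (le_of_eq ?_)
        rw [← mul_add, ← mul_add, ← mul_assoc (ENNReal.ofReal K), ← ENNReal.ofReal_mul hK0.le]
    _ ≤ Φ + ENNReal.ofReal K * (ENNReal.ofReal (c * C₁) * Φ + ENNReal.ofReal (C₂ * C₃) * G +
          ENNReal.ofReal c * G) := by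
        rw [ENNReal.tsum_mul_left, ENNReal.tsum_add, ENNReal.tsum_add]
        gcongr
    _ ≤ (Φ + G) + ENNReal.ofReal K * (ENNReal.ofReal (c * C₁) * (Φ + G) +
          ENNReal.ofReal (C₂ * C₃) * (Φ + G) + ENNReal.ofReal c * (Φ + G)) := by
        gcongr <;> first | exact le_self_add | exact le_add_self
    _ = _ := by
        rw [ENNReal.ofReal_add zero_le_one (by positivity), ENNReal.ofReal_mul hK0.le,
          ENNReal.ofReal_add (by positivity) hc.le,
          ENNReal.ofReal_add (by positivity) (by positivity), ENNReal.ofReal_one]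
        ring

lemma exists_lintegral_rpow_le (d : ℕ) (hd : 1 ≤ d) {ε s q r : ℝ} (hε : 0 < ε) (hs : 0 < s)
    (hq : 1 ≤ q) (hr : 1 ≤ r) : ∃ C : ℝ, 0 < C ∧ ∀ (Ω : Set (Fin d → ℝ))
      (W : WhitneyCovering d Ω), IsUniformDomain W ε → ∀ f : (Fin d → ℝ) → ℝ,
      (∀ Q ∈ W.cubes, IntegrableOn f Q.toSet) →
      ∫⁻ x in Ω, (∫⁻ y in Ω, diffQuotient s q f x y) ^ r ≤
        ENNReal.ofReal C * ∑' Q : W.Index, ∫⁻ x in Q.1.toSet, whitneyEnergy Ω s q f Q.1 x ^ r := by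
  have hr0 : 0 < r := by linarith
  have hr1 : 0 ≤ r - 1 := by linarith
  obtain ⟨C₁, hC₁, h₁⟩ := exists_setLIntegral_diffQuotient_le d hε hs hq
  obtain ⟨C₂, hC₂, h₂⟩ := exists_schur_bound d hd hε hs hr
  refine ⟨C₁ ^ r * 2 ^ (r - 1) * (1 + C₂), by positivity, fun Ω W hW f hf ↦ ?_⟩
  set E := ∑' Q : W.Index, ∫⁻ x in Q.1.toSet, whitneyEnergy Ω s q f Q.1 x ^ r
  have hmean : ∀ Q : W.Index, ENNReal.ofReal (Q.1.side ^ (d : ℝ)) * meanEnergy Ω s q f Q.1 ^ r ≤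
      ∫⁻ x in Q.1.toSet, whitneyEnergy Ω s q f Q.1 x ^ r := by
    intro Q
    have h0 := Q.1.volume_toSet_ne_zero
    have ht := Q.1.volume_toSet_ne_top
    have h := lintegral_rpow_le_measure_univ_mul (volume.restrict Q.1.toSet)
      (whitneyEnergy Ω s q f Q.1) hr
    rw [Measure.restrict_apply_univ] at h
    rw [← Q.1.volume_toSet, meanEnergy, ENNReal.mul_rpow_of_nonneg _ _ hr0.le]
    calc _ ≤ volume Q.1.toSet * ((volume Q.1.toSet)⁻¹ ^ r * (volume Q.1.toSet ^ (r - 1) *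
          ∫⁻ x in Q.1.toSet, whitneyEnergy Ω s q f Q.1 x ^ r)) := by gcongr
      _ = volume Q.1.toSet ^ (1 + -r + (r - 1)) *
          ∫⁻ x in Q.1.toSet, whitneyEnergy Ω s q f Q.1 x ^ r := by
          rw [ENNReal.rpow_add _ _ h0 ht, ENNReal.rpow_add _ _ h0 ht, ENNReal.rpow_one,
            ENNReal.rpow_neg, ENNReal.inv_rpow]
          ring
      _ = _ := by rw [show 1 + -r + (r - 1) = 0 by ring, ENNReal.rpow_zero, one_mul]
  have htail : ∑' Q : W.Index, ENNReal.ofReal (Q.1.side ^ (d : ℝ)) * tailEnergy W s q f Q.1 ^ r ≤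
      ENNReal.ofReal C₂ * E := by
    refine (h₂ Ω W hW fun P ↦ meanEnergy Ω s q f P.1).trans ?_
    gcongr
    exact ENNReal.tsum_le_tsum hmean
  rw [← W.tsum_setLIntegral]
  calc ∑' Q : W.Index, ∫⁻ x in Q.1.toSet, (∫⁻ y in Ω, diffQuotient s q f x y) ^ r ≤
      ∑' Q : W.Index, ENNReal.ofReal (C₁ ^ r * 2 ^ (r - 1)) *
        ((∫⁻ x in Q.1.toSet, whitneyEnergy Ω s q f Q.1 x ^ r) +
          ENNReal.ofReal (Q.1.side ^ (d : ℝ)) * tailEnergy W s q f Q.1 ^ r) := by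
        gcongr with Q
        calc _ ≤ ∫⁻ x in Q.1.toSet, ENNReal.ofReal (C₁ ^ r * 2 ^ (r - 1)) *
              (whitneyEnergy Ω s q f Q.1 x ^ r + tailEnergy W s q f Q.1 ^ r) := by
              refine setLIntegral_mono' Q.1.measurableSet_toSet fun x hx ↦ ?_
              refine (ENNReal.rpow_le_rpow (h₁ Ω W hW f hf Q x hx) hr0.le).trans ?_
              rw [ENNReal.mul_rpow_of_nonneg _ _ hr0.le, ENNReal.ofReal_rpow_of_pos hC₁,
                ENNReal.ofReal_mul (by positivity), mul_assoc]
              gcongr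
              rw [← ENNReal.ofReal_rpow_of_pos (by norm_num), ENNReal.ofReal_ofNat]
              exact ENNReal.rpow_add_le_mul_rpow_add_rpow _ _ hr
          _ = _ := by
              rw [lintegral_const_mul' _ _ ENNReal.ofReal_ne_top,
                lintegral_add_right _ measurable_const, setLIntegral_const, Q.1.volume_toSet,
                mul_comm (tailEnergy W s q f Q.1 ^ r)]
    _ ≤ ENNReal.ofReal (C₁ ^ r * 2 ^ (r - 1)) * (E + ENNReal.ofReal C₂ * E) := by
        rw [ENNReal.tsum_mul_left, ENNReal.tsum_add]
        gcongr
    _ = _ := by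
        rw [ENNReal.ofReal_mul (q := 1 + C₂) (by positivity), ENNReal.ofReal_add zero_le_one hC₂.le,
          ENNReal.ofReal_one]
        ring

/-- self-improvement to Whitney balls, `q ≤ p`: for a uniform domain `Ω`
with admissible Whitney covering `W`, `0 < s < 1`, `1 ≤ q ≤ p < ∞` and `f ∈ L¹_loc(Ω)`,
`(Σ_{Q∈W} ∫_Q (∫_{5Q} |f(x)−f(y)|^q/|x−y|^{sq+d} dy)^{p/q} dx)^{1/p}` is comparable to
`‖f‖_{Ȧ^s_{p,q}(Ω)}`, with constants depending only on `d, s, p, q` and the uniformity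
constants of `Ω`. -/
theorem stmt_16 (d : ℕ) (hd : 1 ≤ d) (ε s p q : ℝ) (hε : 0 < ε) (hs0 : 0 < s) (hs1 : s < 1)
    (hq : 1 ≤ q) (hqp : q ≤ p) :
    ∃ C : ℝ≥0∞, C ≠ 0 ∧ C ≠ ⊤ ∧
      ∀ (Ω : Set (Fin d → ℝ)), IsOpen Ω → IsConnected Ω → Ω ≠ Set.univ →
      ∀ (W : WhitneyCovering d Ω), IsUniformDomain W ε →
      ∀ f : (Fin d → ℝ) → ℝ, MeasureTheory.LocallyIntegrableOn f Ω volume →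
      ((∑' Q : {Q : Cube d // Q ∈ W.cubes},
          ∫⁻ x in (Q : Cube d).toSet,
            (∫⁻ y in Metric.closedBall (Q : Cube d).center (5 * (Q : Cube d).side / 2) ∩ Ω,
                (‖f x - f y‖₊ : ℝ≥0∞) ^ q / edist x y ^ (s * q + d)) ^ (p / q)) ^ (1 / p) ≤
        C * (∫⁻ x in Ω, (∫⁻ y in Ω,
            (‖f x - f y‖₊ : ℝ≥0∞) ^ q / edist x y ^ (s * q + d)) ^ (p / q)) ^ (1 / p)) ∧
      ((∫⁻ x in Ω, (∫⁻ y in Ω,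
            (‖f x - f y‖₊ : ℝ≥0∞) ^ q / edist x y ^ (s * q + d)) ^ (p / q)) ^ (1 / p) ≤
        C * (∑' Q : {Q : Cube d // Q ∈ W.cubes},
          ∫⁻ x in (Q : Cube d).toSet,
            (∫⁻ y in Metric.closedBall (Q : Cube d).center (5 * (Q : Cube d).side / 2) ∩ Ω,
                (‖f x - f y‖₊ : ℝ≥0∞) ^ q / edist x y ^ (s * q + d)) ^ (p / q)) ^ (1 / p)) := by
  have hq0 : 0 < q := by linarith
  have hp0 : 0 < p := by linarith
  obtain ⟨C, hC, h⟩ := exists_lintegral_rpow_le d hd hε hs0 hq ((one_le_div hq0).2 hqp)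
  refine ⟨max 1 (ENNReal.ofReal (C ^ (1 / p))), (zero_lt_one.trans_le (le_max_left _ _)).ne',
    by simp, fun Ω hΩ _ _ W hW f hf ↦ ⟨?_, ?_⟩⟩
  · refine le_trans ?_ (le_mul_of_one_le_left zero_le (le_max_left _ _))
    gcongr
    refine le_trans (ENNReal.tsum_le_tsum fun Q ↦ ?_) (W.tsum_setLIntegral _).le
    refine lintegral_mono fun x ↦ ENNReal.rpow_le_rpow ?_ (by positivity)
    exact lintegral_mono_set Set.inter_subset_right
  · refine le_trans ?_ (mul_le_mul_left (le_max_right _ _) _)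
    rw [← ENNReal.ofReal_rpow_of_pos hC, ← ENNReal.mul_rpow_of_nonneg _ _ (by positivity)]
    gcongr
    exact h Ω W hW f fun Q hQ ↦
      hf.integrableOn_compact_subset (W.toSet_subset hQ) (isCompact_closedBall _ _)
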